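/- Let A be a unital commutative ℝ-algebra generated by a linear subspace V ⊆ A, let Q be a quadratic module in A with K := K_Q, and let q be a Hilbertian seminorm on V such that T := {α ∈ K : α|_V is q-continuous} is nonempty. Let L be a normalized linear functional on A. Then: there exists a representing Radon measure ν for L with support contained in T if and only if there exist a Hilbertian seminorm p on V with tr(p/q) < ∞ and, for each S ∈ J, a representing Radon measure ν_S for L|_S with support contained in K_{Q∩S}, such that the family {ν_S : S ∈ J} is p-concentrated. -/

import Mathlib

open MeasureTheory
open scoped ENNReal

noncomputable section

/-- The character space `X(A)` of a unital commutative `ℝ`-algebra `A`: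
the set of `ℝ`-algebra homomorphisms `A → ℝ`. -/
abbrev Character (A : Type*) [CommRing A] [Algebra ℝ A] := A →ₐ[ℝ] ℝ

/-- The weak topology on the character space: the weakest topology making all
evaluations `α ↦ α a` continuous. -/
instance Character.instTopologicalSpace (A : Type*) [CommRing A] [Algebra ℝ A] :
    TopologicalSpace (Character A) :=
  TopologicalSpace.induced (fun (α : Character A) (a : A) => α a) inferInstance

/-- The Borel σ-algebra on the character space. -/
instance Character.instMeasurableSpace (A : Type*) [CommRing A] [Algebra ℝ A] :
    MeasurableSpace (Character A) :=
  borel (Character A)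

/-- A Radon measure: a locally finite Borel measure that is inner regular with
respect to compact sets. -/
def IsRadonMeasure {X : Type*} [TopologicalSpace X] [MeasurableSpace X]
    (μ : Measure X) : Prop :=
  IsLocallyFiniteMeasure μ ∧ μ.InnerRegularWRT IsCompact MeasurableSet

/-- A Hilbertian seminorm on a real vector space `V`: a seminorm induced by a
symmetric positive semidefinite bilinear form, recorded by the form itself. -/
structure HilbSeminorm (V : Type*) [AddCommGroup V] [Module ℝ V] where
  bilin : V →ₗ[ℝ] V →ₗ[ℝ] ℝ
  symm : ∀ v w, bilin v w = bilin w v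
  nonneg : ∀ v, 0 ≤ bilin v v

namespace HilbSeminorm

variable {V W : Type*} [AddCommGroup V] [Module ℝ V] [AddCommGroup W] [Module ℝ W]

/-- The seminorm associated to a Hilbertian seminorm: `p v = √⟨v,v⟩ₚ`. -/
def toFun (p : HilbSeminorm V) (v : V) : ℝ := Real.sqrt (p.bilin v v)

/-- Pullback of a Hilbertian seminorm along a linear map (e.g. restriction to a
subspace along the inclusion). -/
def comp (p : HilbSeminorm V) (f : W →ₗ[ℝ] V) : HilbSeminorm W where
  bilin := LinearMap.compl₁₂ p.bilin f f
  symm v w := by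
    simp only [LinearMap.compl₁₂_apply]
    exact p.symm (f v) (f w)
  nonneg v := by
    simp only [LinearMap.compl₁₂_apply]
    exact p.nonneg (f v)

/-- The Hilbertian seminorm `c • p`, induced by the bilinear form `c² ⟨·,·⟩ₚ`. -/
def smul (p : HilbSeminorm V) (c : ℝ) : HilbSeminorm V where
  bilin := c ^ 2 • p.bilin
  symm v w := by
    simp only [LinearMap.smul_apply, smul_eq_mul]
    rw [p.symm v w]
  nonneg v := by
    simp only [LinearMap.smul_apply, smul_eq_mul]
    exact mul_nonneg (sq_nonneg c) (p.nonneg v)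

/-- A finite subset `E ⊆ V` is `q`-orthonormal. -/
def IsONS (q : HilbSeminorm V) (E : Finset V) : Prop :=
  (∀ e ∈ E, q.bilin e e = 1) ∧ ∀ e ∈ E, ∀ f ∈ E, e ≠ f → q.bilin e f = 0

open scoped Classical

/-- The trace `tr(p/q)` of a Hilbertian seminorm `p` with respect to a Hilbertian
seminorm `q`: the supremum over finite `q`-orthonormal sets `E` of `∑_{e∈E} p(e)²`
if `ker q ⊆ ker p`, and `∞` otherwise. -/
def trace (p q : HilbSeminorm V) : ℝ≥0∞ :=
  if ∀ v, q.bilin v v = 0 → p.bilin v v = 0 then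
    ⨆ (E : Finset V) (_ : q.IsONS E), ENNReal.ofReal (∑ e ∈ E, p.bilin e e)
  else ⊤

end HilbSeminorm

section AlgebraDefs

variable {A : Type*} [CommRing A] [Algebra ℝ A]

/-- The restriction `α|_V` of a character `α` is `q`-continuous. -/
def QContOn (V : Submodule ℝ A) (q : ↥V → ℝ) (α : Character A) : Prop :=
  ∃ C > 0, ∀ v : V, |α (v : A)| ≤ C * q v

/-- `J`: the family of all subalgebras of `A` generated by finite-dimensional
subspaces of `V`. -/
def finGenSubalgebras (V : Submodule ℝ A) : Set (Subalgebra ℝ A) :=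
  {S | ∃ W : Submodule ℝ A, W ≤ V ∧ FiniteDimensional ℝ ↥W ∧
    S = Algebra.adjoin ℝ (W : Set A)}

/-- The family `{ν_S : S ∈ J}` is `p`-concentrated. -/
def Concentrated (V : Submodule ℝ A) (J : Set (Subalgebra ℝ A)) (p : ↥V → ℝ)
    (ν : ∀ S : Subalgebra ℝ A, Measure (Character ↥S)) : Prop :=
  ∀ ε > (0 : ℝ), ∃ δ > (0 : ℝ), ∀ S ∈ J, ∀ v : V, ∀ hv : (v : A) ∈ S,
    p v ≤ δ → ν S {α : Character ↥S | 1 ≤ |α ⟨(v : A), hv⟩|} ≤ ENNReal.ofReal ε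

/-- A quadratic module in `A`. -/
def IsQuadraticModule (Q : Set A) : Prop :=
  (1 : A) ∈ Q ∧ (∀ x ∈ Q, ∀ y ∈ Q, x + y ∈ Q) ∧ ∀ a : A, ∀ x ∈ Q, a ^ 2 * x ∈ Q

/-- The nonnegativity set `K_Q ⊆ X(A)` of a quadratic module `Q`. -/
def charNonneg (Q : Set A) : Set (Character A) := {α | ∀ a ∈ Q, 0 ≤ α a}

/-- The nonnegativity set `K_{Q ∩ S} ⊆ X(S)` for a subalgebra `S`. -/
def charNonnegOn (Q : Set A) (S : Subalgebra ℝ A) : Set (Character ↥S) :=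
  {α | ∀ a : S, (a : A) ∈ Q → 0 ≤ α a}

/-- The Hilbertian seminorm `s_L(a) = √(L(a²))` induced by a `∑A²`-positive
linear functional `L`, via the bilinear form `(a,b) ↦ L(ab)`. -/
def sLSeminorm (L : A →ₗ[ℝ] ℝ) (hL : ∀ a : A, 0 ≤ L (a * a)) : HilbSeminorm A where
  bilin := (LinearMap.mul ℝ A).compr₂ L
  symm v w := by simp [mul_comm]
  nonneg v := by simpa using hL v

end AlgebraDefs

/-- `τ` is the topology induced by a directed family `P` of Hilbertian
seminorms. -/
def InducedByHilbFamily {V : Type*} [AddCommGroup V] [Module ℝ V]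
    (τ : TopologicalSpace V) (P : Set (HilbSeminorm V)) : Prop :=
  (∀ p ∈ P, ∀ q ∈ P, ∃ r ∈ P, ∀ v, p.toFun v ≤ r.toFun v ∧ q.toFun v ≤ r.toFun v) ∧
  ∀ v : V, (@nhds V τ v).HasBasis
    (fun pe : HilbSeminorm V × ℝ => pe.1 ∈ P ∧ 0 < pe.2)
    (fun pe => {w | pe.1.toFun (w - v) < pe.2})

/-- A topology is nuclear (in the sense of Yamasaki) if it is induced by a
directed family `P` of Hilbertian seminorms such that every `p ∈ P` admits
`q ∈ P` with `tr(p/q) < ∞`. -/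
def IsNuclearTopology {V : Type*} [AddCommGroup V] [Module ℝ V]
    (τ : TopologicalSpace V) : Prop :=
  ∃ P : Set (HilbSeminorm V), InducedByHilbFamily τ P ∧
    ∀ p ∈ P, ∃ q ∈ P, p.trace q < ⊤

end

section

open Filter Topology

namespace Character

variable {A : Type*} [CommRing A] [Algebra ℝ A]

instance instBorelSpace : BorelSpace (Character A) := ⟨rfl⟩

lemma isInducing_coe : Topology.IsInducing (fun (α : Character A) (a : A) => α a) := ⟨rfl⟩

lemma continuous_eval (a : A) : Continuous fun α : Character A => α a :=
  (continuous_apply a).comp isInducing_coe.continuous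

lemma continuous_comp {B : Type*} [CommRing B] [Algebra ℝ B] (f : B →ₐ[ℝ] A) :
    Continuous fun α : Character A => (α.comp f : Character B) :=
  isInducing_coe.continuous_iff.2 (continuous_pi fun b => continuous_eval (f b))

lemma isProbabilityMeasure_of_integral_eq {ℓ : A →ₗ[ℝ] ℝ} (h1 : ℓ 1 = 1)
    {μ : Measure (Character A)} (h : ∀ a, ℓ a = ∫ α : Character A, α a ∂μ) :
    IsProbabilityMeasure μ := by
  have h0 := h 1
  simp only [h1, map_one, integral_const, smul_eq_mul, mul_one] at h0
  exact ⟨by rw [← ENNReal.toReal_eq_one_iff]; exact h0.symm⟩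

/-- If the Bochner integrals of all evaluations against `μ` agree with a normalized linear
functional, then every evaluation is `μ`-integrable. -/
lemma integrable_eval_of_integral_eq {ℓ : A →ₗ[ℝ] ℝ} (h1 : ℓ 1 = 1)
    {μ : Measure (Character A)} (h : ∀ a, ℓ a = ∫ α : Character A, α a ∂μ) (a : A) :
    Integrable (fun α : Character A => α a) μ := by
  have := isProbabilityMeasure_of_integral_eq h1 h
  by_contra hn
  have ha : ℓ a = 0 := by rw [h, integral_undef hn]
  have hn' : ¬ Integrable (fun α : Character A => α (1 + a)) μ := by
    intro hi
    refine hn ((hi.sub (integrable_const (1 : ℝ))).congr (.of_forall fun α => ?_))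
    simp
  have h2 : ℓ (1 + a) = 0 := by rw [h, integral_undef hn']
  rw [map_add, ha, h1] at h2
  norm_num at h2

lemma isClosed_charNonneg (Q : Set A) : IsClosed (charNonneg Q) := by
  simp only [charNonneg, Set.ofPred_forall]
  exact isClosed_biInter fun a _ => isClosed_le continuous_const (continuous_eval a)

lemma isClosed_charNonnegOn (Q : Set A) (S : Subalgebra ℝ A) : IsClosed (charNonnegOn Q S) := by
  simp only [charNonnegOn, Set.ofPred_forall]
  exact isClosed_iInter fun a => isClosed_iInter fun _ =>
    isClosed_le continuous_const (continuous_eval a)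

/-- The characters whose restriction to `V` is dominated by `C • q`. -/
def boundedOn (V : Submodule ℝ A) (q : ↥V → ℝ) (C : ℝ) : Set (Character A) :=
  {α | ∀ v : V, |α (v : A)| ≤ C * q v}

lemma isClosed_boundedOn (V : Submodule ℝ A) (q : ↥V → ℝ) (C : ℝ) :
    IsClosed (boundedOn V q C) := by
  simp only [boundedOn, Set.ofPred_forall]
  exact isClosed_iInter fun v => isClosed_le (continuous_eval _).abs continuous_const

lemma boundedOn_mono {V : Submodule ℝ A} {q : ↥V → ℝ} (hq : ∀ v, 0 ≤ q v) {C D : ℝ}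
    (h : C ≤ D) : boundedOn V q C ⊆ boundedOn V q D := fun _ hα v =>
  (hα v).trans (mul_le_mul_of_nonneg_right h (hq v))

lemma qContOn_iff_exists_nat {V : Submodule ℝ A} {q : ↥V → ℝ} (hq : ∀ v, 0 ≤ q v)
    {α : Character A} : QContOn V q α ↔ ∃ n : ℕ, α ∈ boundedOn V q n := by
  constructor
  · rintro ⟨C, -, hC⟩
    obtain ⟨n, hn⟩ := exists_nat_ge C
    exact ⟨n, boundedOn_mono hq hn hC⟩
  · rintro ⟨n, hn⟩
    exact ⟨n + 1, by positivity, boundedOn_mono hq (by linarith) hn⟩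

open scoped Classical in
/-- A measurable choice of a bound witnessing `q`-continuity. -/
lemma exists_measurable_bound {V : Submodule ℝ A} {q : ↥V → ℝ} (hq : ∀ v, 0 ≤ q v) :
    ∃ N : Character A → ℕ, Measurable N ∧
      (∀ α, QContOn V q α → α ∈ boundedOn V q (N α)) ∧
      ∀ (n : ℕ), ∀ α ∈ boundedOn V q n, N α ≤ n := by
  have hp : ∀ α : Character A, ∃ n : ℕ,
      α ∈ boundedOn V q n ∨ ¬ ∃ k : ℕ, α ∈ boundedOn V q k := by
    intro α
    by_cases h : ∃ k : ℕ, α ∈ boundedOn V q k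
    · exact h.imp fun _ => Or.inl
    · exact ⟨0, Or.inr h⟩
  refine ⟨fun α => Nat.find (hp α), measurable_find hp fun k => ?_, fun α hα => ?_,
    fun n α hα => Nat.find_min' _ (Or.inl hα)⟩
  · have hm (k : ℕ) : MeasurableSet (boundedOn V q (k : ℝ)) :=
      (isClosed_boundedOn V q k).measurableSet
    have : MeasurableSet (⋃ k : ℕ, boundedOn V q (k : ℝ))ᶜ := (MeasurableSet.iUnion hm).compl
    convert (hm k).union this using 1
    ext α
    simp
  · exact (Nat.find_spec (hp α)).resolve_right
      (not_not.2 ((qContOn_iff_exists_nat hq).1 hα))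

end Character

namespace HilbSeminorm

variable {V : Type*} [AddCommGroup V] [Module ℝ V]

lemma toFun_nonneg (q : HilbSeminorm V) (v : V) : 0 ≤ q.toFun v := Real.sqrt_nonneg _

lemma sq_toFun (q : HilbSeminorm V) (v : V) : q.toFun v ^ 2 = q.bilin v v :=
  Real.sq_sqrt (q.nonneg v)

lemma toFun_smul (q : HilbSeminorm V) (c : ℝ) (v : V) : q.toFun (c • v) = |c| * q.toFun v := by
  rw [toFun, toFun, ← Real.sqrt_sq_eq_abs, ← Real.sqrt_mul (sq_nonneg c)]
  simp [sq, mul_assoc]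

lemma toFun_le_iff (q : HilbSeminorm V) {v : V} {c : ℝ} (hc : 0 ≤ c) :
    q.toFun v ≤ c ↔ q.bilin v v ≤ c ^ 2 := Real.sqrt_le_left hc

lemma bilin_eq_zero (q : HilbSeminorm V) {v : V} (hv : q.bilin v v = 0) (w : V) :
    q.bilin v w = 0 := by
  have := LinearMap.BilinForm.apply_mul_apply_le_of_forall_zero_le q.bilin q.nonneg v w
  rw [hv, zero_mul, q.symm w v] at this
  exact mul_self_eq_zero.1 (le_antisymm this (mul_self_nonneg _))

/-- The kernel of a Hilbertian seminorm. -/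
def ker (q : HilbSeminorm V) : Submodule ℝ V where
  carrier := {v | q.bilin v v = 0}
  zero_mem' := by simp
  add_mem' {v w} hv hw := by
    have hv' : q.bilin v v = 0 := hv
    have hw' : q.bilin w w = 0 := hw
    simp [q.bilin_eq_zero hv', q.bilin_eq_zero hw']
  smul_mem' c v hv := by
    have hv' : q.bilin v v = 0 := hv
    simp [hv']

variable {q : HilbSeminorm V}

lemma bilin_sum_smul {E : Finset V} (hE : q.IsONS E) (x : V → ℝ) :
    q.bilin (∑ e ∈ E, x e • e) (∑ e ∈ E, x e • e) = ∑ e ∈ E, x e ^ 2 := by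
  simp only [map_sum, LinearMap.sum_apply, map_smul, LinearMap.smul_apply, smul_eq_mul]
  refine Finset.sum_congr rfl fun e he => ?_
  rw [Finset.sum_eq_single e]
  · rw [hE.1 e he]; ring
  · intro f hf hfe
    rw [hE.2 f hf e he hfe]; ring
  · exact fun h => absurd he h

lemma sum_sq_le_of_abs_le {E : Finset V} (hE : q.IsONS E) {f : V →ₗ[ℝ] ℝ} {C : ℝ}
    (hf : ∀ v, |f v| ≤ C * q.toFun v) : ∑ e ∈ E, f e ^ 2 ≤ C ^ 2 := by
  set s := ∑ e ∈ E, f e ^ 2 with hs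
  have hs0 : 0 ≤ s := Finset.sum_nonneg fun _ _ => sq_nonneg _
  have h := hf (∑ e ∈ E, f e • e)
  have h1 : f (∑ e ∈ E, f e • e) = s := by
    simp [hs, sq]
  rw [h1, abs_of_nonneg hs0] at h
  have h2 : s ^ 2 ≤ C ^ 2 * s := by
    calc s ^ 2 ≤ (C * q.toFun (∑ e ∈ E, f e • e)) ^ 2 := pow_le_pow_left₀ hs0 h 2
      _ = C ^ 2 * s := by rw [mul_pow, q.sq_toFun, bilin_sum_smul hE]
  by_contra! hlt
  nlinarith [sq_nonneg C]

lemma sum_sq_bilin_le {E : Finset V} (hE : q.IsONS E) (v : V) :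
    ∑ e ∈ E, q.bilin v e ^ 2 ≤ q.toFun v ^ 2 := by
  refine sum_sq_le_of_abs_le hE (f := q.bilin v) fun w => ?_
  refine abs_le_of_sq_le_sq ?_ (mul_nonneg (q.toFun_nonneg _) (q.toFun_nonneg _))
  have := LinearMap.BilinForm.apply_mul_apply_le_of_forall_zero_le q.bilin q.nonneg v w
  rw [q.symm w v] at this
  rw [mul_pow, q.sq_toFun, q.sq_toFun, sq]
  exact this

lemma sub_sum_bilin (E : Finset V) (hE : q.IsONS E) (v : V) {e : V} (he : e ∈ E) :
    q.bilin (v - ∑ f ∈ E, q.bilin v f • f) e = 0 := by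
  simp only [map_sub, LinearMap.sub_apply, map_sum, LinearMap.sum_apply, map_smul,
    LinearMap.smul_apply, smul_eq_mul]
  rw [Finset.sum_eq_single e, hE.1 e he, mul_one, sub_self]
  · intro f hf hfe
    rw [hE.2 f hf e he hfe, mul_zero]
  · exact fun h => absurd he h

open scoped Classical in
/-- Gram–Schmidt: any finite set is contained in the span of a finite `q`-orthonormal
set up to the kernel of `q`. -/
lemma exists_isONS (q : HilbSeminorm V) (F : Finset V) : ∃ E : Finset V, q.IsONS E ∧
    (E : Set V) ⊆ Submodule.span ℝ (F : Set V) ∧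
    ∀ v ∈ F, v - ∑ e ∈ E, q.bilin v e • e ∈ q.ker := by
  induction F using Finset.induction_on with
  | empty => exact ⟨∅, by simp [IsONS]⟩
  | insert v F _ ih =>
    obtain ⟨E, hE, hEF, hF⟩ := ih
    have hsub : (Submodule.span ℝ (F : Set V) : Set V) ⊆
        Submodule.span ℝ ((insert v F : Finset V) : Set V) :=
      Submodule.span_mono (by simp)
    set w := v - ∑ e ∈ E, q.bilin v e • e with hw
    by_cases h0 : w ∈ q.ker
    · refine ⟨E, hE, hEF.trans hsub, fun u hu => ?_⟩
      rcases Finset.mem_insert.1 hu with rfl | hu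
      exacts [h0, hF u hu]
    have hpos : 0 < q.toFun w :=
      Real.sqrt_pos.2 (lt_of_le_of_ne (q.nonneg w) (Ne.symm h0))
    set e' := (q.toFun w)⁻¹ • w with he'
    have horth : ∀ e ∈ E, q.bilin e' e = 0 := fun e he => by
      simp [he', hw, sub_sum_bilin E hE v he, -map_sub]
    have hnorm : q.bilin e' e' = 1 := by
      simp only [he', map_smul, LinearMap.smul_apply, smul_eq_mul, ← q.sq_toFun]
      field_simp
    have hnot : e' ∉ E := fun h => by
      have := horth e' h
      rw [hnorm] at this
      exact one_ne_zero this
    have hwspan : w ∈ Submodule.span ℝ ((insert v F : Finset V) : Set V) := by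
      refine Submodule.sub_mem _ (Submodule.subset_span (by simp))
        (Submodule.sum_mem _ fun e he => Submodule.smul_mem _ _ (hsub (hEF he)))
    refine ⟨insert e' E, ⟨?_, ?_⟩, ?_, ?_⟩
    · intro e he
      rcases Finset.mem_insert.1 he with rfl | he
      exacts [hnorm, hE.1 e he]
    · intro e he f hf hef
      rcases Finset.mem_insert.1 he with rfl | he <;> rcases Finset.mem_insert.1 hf with rfl | hf
      · exact absurd rfl hef
      · exact horth f hf
      · rw [q.symm]; exact horth e he
      · exact hE.2 e he f hf hef
    · intro e he
      rcases Finset.mem_insert.1 (Finset.mem_coe.1 he) with rfl | he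
      exacts [Submodule.smul_mem _ _ hwspan, hsub (hEF he)]
    · intro u hu
      rw [Finset.sum_insert hnot]
      rcases Finset.mem_insert.1 hu with rfl | hu
      · have h1 : q.bilin u e' • e' = w := by
          have h2 : q.bilin u w = q.toFun w ^ 2 := by
            have h3 : u = w + ∑ e ∈ E, q.bilin u e • e := by simp [hw]
            have h4 : q.bilin (∑ e ∈ E, q.bilin u e • e) w = 0 := by
              rw [q.symm, map_sum]
              exact Finset.sum_eq_zero fun e he => by
                rw [map_smul, hw, sub_sum_bilin E hE u he, smul_zero]
            rw [q.sq_toFun]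
            conv_lhs => rw [h3]
            rw [map_add, LinearMap.add_apply, h4, add_zero]
          rw [he', map_smul, h2, smul_smul]
          have : (q.toFun w)⁻¹ • q.toFun w ^ 2 * (q.toFun w)⁻¹ = 1 := by
            rw [smul_eq_mul]; field_simp
          rw [this, one_smul]
        rw [h1, add_comm, ← sub_sub, ← hw, sub_self]
        exact zero_mem _
      · have h5 : q.bilin u e' = 0 := by
          have h3 : u = (u - ∑ e ∈ E, q.bilin u e • e) + ∑ e ∈ E, q.bilin u e • e := by simp
          rw [h3, map_add, LinearMap.add_apply, q.bilin_eq_zero (hF u hu), zero_add, q.symm,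
            map_sum]
          exact Finset.sum_eq_zero fun e he => by
            rw [map_smul, horth e he, smul_zero]
        rw [h5, zero_smul, zero_add]
        exact hF u hu

lemma trace_lt_top {p q : HilbSeminorm V} (h : p.trace q < ⊤) :
    (∀ v, q.bilin v v = 0 → p.bilin v v = 0) ∧
      ∃ t : ℝ, 0 ≤ t ∧ ∀ E, q.IsONS E → ∑ e ∈ E, p.bilin e e ≤ t := by
  classical
  unfold trace at h
  split_ifs at h with hk
  · refine ⟨hk, (⨆ (E : Finset V) (_ : q.IsONS E),
      ENNReal.ofReal (∑ e ∈ E, p.bilin e e)).toReal, ENNReal.toReal_nonneg, fun E hE => ?_⟩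
    rw [← ENNReal.ofReal_le_iff_le_toReal h.ne]
    exact le_iSup₂ (f := fun (E : Finset V) (_ : q.IsONS E) =>
      ENNReal.ofReal (∑ e ∈ E, p.bilin e e)) E hE
  · exact absurd h (lt_irrefl _)

lemma trace_lt_top_of_le {p q : HilbSeminorm V}
    (hk : ∀ v, q.bilin v v = 0 → p.bilin v v = 0) {t : ℝ}
    (ht : ∀ E, q.IsONS E → ∑ e ∈ E, p.bilin e e ≤ t) : p.trace q < ⊤ := by
  classical
  unfold trace
  rw [if_pos hk]
  exact lt_of_le_of_lt (iSup₂_le fun E hE => ENNReal.ofReal_le_ofReal (ht E hE))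
    ENNReal.ofReal_lt_top

end HilbSeminorm

lemma IsRadonMeasure.map {X Y : Type*} [TopologicalSpace X] [MeasurableSpace X] [BorelSpace X]
    [TopologicalSpace Y] [MeasurableSpace Y] [BorelSpace Y] {μ : Measure X} [IsFiniteMeasure μ]
    (h : IsRadonMeasure μ) {f : X → Y} (hf : Continuous f) : IsRadonMeasure (μ.map f) :=
  ⟨inferInstance, h.2.map hf.aemeasurable (fun _ hs => hf.measurable hs)
    (fun _ hK => hK.image hf) fun _ hs => hs⟩

section Forward

variable {A : Type*} [CommRing A] [Algebra ℝ A]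

/-- Integration of evaluations against `μ` with a bounded weight `w`, as a linear functional. -/
noncomputable def weightedIntegral (μ : Measure (Character A)) (w : Character A → ℝ)
    (hw : ∀ a : A, Integrable (fun α : Character A => α a * w α) μ) : A →ₗ[ℝ] ℝ where
  toFun a := ∫ α, α a * w α ∂μ
  map_add' a b := by
    rw [← integral_add (hw a) (hw b)]
    simp [add_mul]
  map_smul' c a := by
    rw [RingHom.id_apply, smul_eq_mul, ← integral_const_mul]
    simp [mul_assoc]

/-- A probability measure on characters with integrable evaluations that is carried by the
`q`-continuous characters is concentrated for some Hilbertian seminorm `p` with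
`tr(p/q) < ∞`. -/
lemma exists_hilbSeminorm_concentrated (V : Submodule ℝ A) (q : HilbSeminorm ↥V)
    (μ : Measure (Character A)) [IsProbabilityMeasure μ]
    (hint : ∀ a : A, Integrable (fun α : Character A => α a) μ)
    (hq : ∀ᵐ α ∂μ, QContOn V q.toFun α) :
    ∃ p : HilbSeminorm ↥V, p.trace q < ⊤ ∧ ∀ ε > (0 : ℝ), ∃ δ > (0 : ℝ), ∀ v : V,
      p.toFun v ≤ δ → μ {α : Character A | 1 ≤ |α (v : A)|} ≤ ENNReal.ofReal ε := by
  obtain ⟨N, hNm, hN, hNle⟩ := Character.exists_measurable_bound q.toFun_nonneg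
  set w : Character A → ℝ := fun α => (1 + (N α : ℝ) ^ 2)⁻¹ with hwdef
  have hwm : Measurable w := by
    have : Measurable fun α => (N α : ℝ) := measurable_from_nat.comp hNm
    fun_prop
  have hw0 (α) : 0 < w α := by positivity
  have hw1 (α) : w α ≤ 1 := inv_le_one_of_one_le₀ (by nlinarith [sq_nonneg (N α : ℝ)])
  have hwint (a : A) : Integrable (fun α : Character A => α a * w α) μ :=
    (hint a).mul_bdd (c := 1) hwm.aestronglyMeasurable
      (.of_forall fun α => by rw [Real.norm_of_nonneg (hw0 α).le]; exact hw1 α)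
  have hpos (a : A) : 0 ≤ weightedIntegral μ w hwint (a * a) :=
    integral_nonneg fun α => by
      simp only [map_mul, Pi.zero_apply]
      exact mul_nonneg (mul_self_nonneg _) (hw0 α).le
  set p : HilbSeminorm ↥V := (sLSeminorm _ hpos).comp V.subtype with hp
  have hpv (v : V) : p.bilin v v = ∫ α : Character A, α ((v : A) * v) * w α ∂μ := rfl
  refine ⟨p, HilbSeminorm.trace_lt_top_of_le (t := 1) (fun v hv => ?_) (fun E hE => ?_), ?_⟩
  · rw [hpv]
    refine integral_eq_zero_of_ae ?_
    filter_upwards [hq] with α hα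
    have h0 := hN α hα v
    rw [HilbSeminorm.toFun, hv, Real.sqrt_zero, mul_zero] at h0
    simp [abs_nonpos_iff.1 h0]
  · simp only [hpv]
    rw [← integral_finsetSum _ fun e _ => hwint _]
    have : ∫ α : Character A, ∑ e ∈ E, α ((e : A) * e) * w α ∂μ ≤ ∫ _ : Character A, (1 : ℝ) ∂μ := by
      refine integral_mono_ae (integrable_finsetSum _ fun e _ => hwint _)
        (integrable_const _) ?_
      filter_upwards [hq] with α hα
      have h1 := HilbSeminorm.sum_sq_le_of_abs_le hE
        (f := α.toLinearMap.comp V.subtype) (C := N α) (hN α hα)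
      simp only [LinearMap.comp_apply, Submodule.subtype_apply, AlgHom.toLinearMap_apply] at h1
      simp only [← sq, map_pow, ← Finset.sum_mul]
      rw [hwdef, ← div_eq_mul_inv]
      exact div_le_one_of_le₀ (by linarith) (by positivity)
    simpa using this
  · intro ε hε
    set B : ℕ → Set (Character A) := fun n => (Character.boundedOn V q.toFun n)ᶜ with hB
    have hBlim : Tendsto (μ ∘ B) atTop (𝓝 (μ (⋂ n, B n))) :=
      tendsto_measure_iInter_atTop
        (fun n => (Character.isClosed_boundedOn V _ _).measurableSet.compl.nullMeasurableSet)
        (fun m n hmn => Set.compl_subset_compl.2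
          (Character.boundedOn_mono q.toFun_nonneg (Nat.cast_le.2 hmn)))
        ⟨0, measure_ne_top _ _⟩
    have hB0 : μ (⋂ n, B n) = 0 := by
      refine measure_mono_null (t := {α | ¬ QContOn V q.toFun α}) (fun α hα h => ?_) hq
      obtain ⟨n, hn⟩ := (Character.qContOn_iff_exists_nat q.toFun_nonneg).1 h
      exact Set.mem_iInter.1 hα n hn
    rw [hB0] at hBlim
    obtain ⟨n, hn⟩ := (hBlim.eventually_le_const
      (ENNReal.ofReal_pos.2 (half_pos hε))).exists
    set c : ℝ := (1 + (n : ℝ) ^ 2)⁻¹ with hc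
    have hc0 : 0 < c := by positivity
    refine ⟨Real.sqrt (ε / 2 * c), Real.sqrt_pos.2 (by positivity), fun v hv => ?_⟩
    rw [p.toFun_le_iff (Real.sqrt_nonneg _), Real.sq_sqrt (by positivity), hpv] at hv
    have hsub : {α : Character A | 1 ≤ |α (v : A)|} ⊆
        B n ∪ {α : Character A | c ≤ α ((v : A) * v) * w α} := by
      intro α hα
      by_cases hb : α ∈ B n
      · exact Or.inl hb
      refine Or.inr ?_
      have h1 : N α ≤ n := hNle n α (not_not.1 hb)
      have h2 : c ≤ w α := by
        simp only [hc, hwdef]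
        gcongr
      have h3 : 1 ≤ α ((v : A) * v) := by
        rw [map_mul, ← abs_mul_abs_self]
        have : (1 : ℝ) ≤ |α (v : A)| := hα
        nlinarith
      change c ≤ _ * _
      nlinarith
    have hmark := mul_meas_ge_le_integral_of_nonneg (μ := μ)
      (f := fun α : Character A => α ((v : A) * v) * w α)
      (.of_forall fun α => by
        simp only [map_mul, Pi.zero_apply]
        exact mul_nonneg (mul_self_nonneg _) (hw0 α).le) (hwint _) c
    have h4 : μ.real {α : Character A | c ≤ α ((v : A) * v) * w α} ≤ ε / 2 := by
      refine le_of_mul_le_mul_left ?_ hc0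
      linarith
    calc μ {α : Character A | 1 ≤ |α (v : A)|}
        ≤ μ (B n) + μ {α : Character A | c ≤ α ((v : A) * v) * w α} :=
          (measure_mono hsub).trans (measure_union_le _ _)
      _ ≤ ENNReal.ofReal (ε / 2) + ENNReal.ofReal (ε / 2) :=
          add_le_add hn ((ENNReal.le_ofReal_iff_toReal_le (measure_ne_top _ _) (by positivity)).2 h4)
      _ = ENNReal.ofReal ε := by
          rw [← ENNReal.ofReal_add (by positivity) (by positivity), add_halves]

lemma exists_concentrated_of_representing (V : Submodule ℝ A) (Q : Set A) (q : HilbSeminorm ↥V)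
    (L : A →ₗ[ℝ] ℝ) (hL1 : L 1 = 1) (μ : Measure (Character A)) (hμ : IsRadonMeasure μ)
    (hL : ∀ a : A, L a = ∫ α : Character A, α a ∂μ)
    (hsupp : μ {α : Character A | ¬ (α ∈ charNonneg Q ∧ QContOn V q.toFun α)} = 0) :
    ∃ p : HilbSeminorm ↥V, p.trace q < ⊤ ∧
      ∃ ν : ∀ S : Subalgebra ℝ A, Measure (Character ↥S),
        (∀ S ∈ finGenSubalgebras V, IsRadonMeasure (ν S) ∧
          (∀ a : S, L (a : A) = ∫ α : Character ↥S, α a ∂(ν S)) ∧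
          ν S {α : Character ↥S | α ∉ charNonnegOn Q S} = 0) ∧
        Concentrated V (finGenSubalgebras V) p.toFun ν := by
  have := Character.isProbabilityMeasure_of_integral_eq hL1 hL
  have hsupp' : ∀ᵐ α ∂μ, α ∈ charNonneg Q ∧ QContOn V q.toFun α := hsupp
  obtain ⟨p, hp, hconc⟩ := exists_hilbSeminorm_concentrated V q μ
    (Character.integrable_eval_of_integral_eq hL1 hL) (hsupp'.mono fun _ h => h.2)
  have hres (S : Subalgebra ℝ A) :
      Continuous fun α : Character A => (α.comp S.val : Character S) :=
    Character.continuous_comp S.val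
  refine ⟨p, hp, fun S => μ.map fun α => α.comp S.val, fun S _ => ⟨hμ.map (hres S), ?_, ?_⟩, ?_⟩
  · intro a
    rw [integral_map (hres S).aemeasurable
      (Character.continuous_eval a).measurable.aestronglyMeasurable, hL]
    rfl
  · change Measure.map _ μ (charNonnegOn Q S)ᶜ = 0
    rw [Measure.map_apply (hres S).measurable
      (Character.isClosed_charNonnegOn Q S).measurableSet.compl]
    refine measure_mono_null (fun α hα => ?_) hsupp
    exact fun h => hα fun a ha => h.1 a ha
  · intro ε hε
    obtain ⟨δ, hδ, h⟩ := hconc ε hε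
    refine ⟨δ, hδ, fun S _ v hv hpv => ?_⟩
    rw [Measure.map_apply (hres S).measurable
      (isClosed_le continuous_const (Character.continuous_eval _).abs).measurableSet]
    exact h v hpv

end Forward

section RandomSigns

open scoped Classical in
/-- The sign `±1` attached to `i` by a set `t` of positive indices. -/
noncomputable def finsetSign {ι : Type*} (t : Finset ι) (i : ι) : ℝ := if i ∈ t then 1 else -1

lemma finsetSign_of_notMem {ι : Type*} {t : Finset ι} {i : ι} (h : i ∉ t) :
    finsetSign t i = -1 := if_neg h

open scoped Classical in
lemma finsetSign_insert_self {ι : Type*} (t : Finset ι) (i : ι) :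
    finsetSign (insert i t) i = 1 := if_pos (Finset.mem_insert_self _ _)

open scoped Classical in
lemma finsetSign_insert_of_ne {ι : Type*} (t : Finset ι) {i j : ι} (h : j ≠ i) :
    finsetSign (insert i t) j = finsetSign t j := by
  simp [finsetSign, h]

variable {ι M : Type*} [AddCommGroup M] [Module ℝ M]

open scoped Classical in
lemma sum_finsetSign_insert {E t : Finset ι} {a : ι} (ha : a ∉ E) (ht : t ⊆ E) (x : ι → M) :
    ∑ i ∈ insert a E, finsetSign t i • x i = ∑ i ∈ E, finsetSign t i • x i - x a ∧
    ∑ i ∈ insert a E, finsetSign (insert a t) i • x i =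
      ∑ i ∈ E, finsetSign t i • x i + x a := by
  have h : ∑ i ∈ E, finsetSign (insert a t) i • x i = ∑ i ∈ E, finsetSign t i • x i :=
    Finset.sum_congr rfl fun i hi => by
      rw [finsetSign_insert_of_ne t (ne_of_mem_of_not_mem hi ha)]
  rw [Finset.sum_insert ha, Finset.sum_insert ha, finsetSign_insert_self, h,
    finsetSign_of_notMem fun h => ha (ht h)]
  constructor <;> module

lemma sum_powerset_bilin_finsetSign (B : M →ₗ[ℝ] M →ₗ[ℝ] ℝ) (E : Finset ι) (x : ι → M) :
    ∑ t ∈ E.powerset, B (∑ i ∈ E, finsetSign t i • x i) (∑ i ∈ E, finsetSign t i • x i) =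
      2 ^ E.card * ∑ i ∈ E, B (x i) (x i) := by
  classical
  induction E using Finset.induction_on with
  | empty => simp
  | insert a E ha ih =>
    rw [Finset.sum_powerset_insert ha, ← Finset.sum_add_distrib, Finset.card_insert_of_notMem ha,
      Finset.sum_insert ha]
    have : ∀ t ∈ E.powerset,
        B (∑ i ∈ insert a E, finsetSign t i • x i) (∑ i ∈ insert a E, finsetSign t i • x i) +
        B (∑ i ∈ insert a E, finsetSign (insert a t) i • x i)
          (∑ i ∈ insert a E, finsetSign (insert a t) i • x i) =
        2 * B (∑ i ∈ E, finsetSign t i • x i) (∑ i ∈ E, finsetSign t i • x i) +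
          2 * B (x a) (x a) := by
      intro t ht
      obtain ⟨h1, h2⟩ := sum_finsetSign_insert ha (Finset.mem_powerset.1 ht) x
      rw [h1, h2]
      simp only [map_sub, map_add, LinearMap.sub_apply, LinearMap.add_apply]
      ring
    rw [Finset.sum_congr rfl this, Finset.sum_add_distrib, ← Finset.mul_sum, ih,
      Finset.sum_const, Finset.card_powerset, nsmul_eq_mul]
    push_cast
    ring

lemma sum_powerset_sq_finsetSign (E : Finset ι) (x : ι → ℝ) :
    ∑ t ∈ E.powerset, (∑ i ∈ E, finsetSign t i * x i) ^ 2 = 2 ^ E.card * ∑ i ∈ E, x i ^ 2 := by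
  simpa only [sq, smul_eq_mul, LinearMap.mul_apply'] using
    sum_powerset_bilin_finsetSign (LinearMap.mul ℝ ℝ) E x

lemma sum_powerset_pow_four_finsetSign_le (E : Finset ι) (x : ι → ℝ) :
    ∑ t ∈ E.powerset, (∑ i ∈ E, finsetSign t i * x i) ^ 4 ≤
      2 ^ E.card * (3 * (∑ i ∈ E, x i ^ 2) ^ 2) := by
  classical
  induction E using Finset.induction_on with
  | empty => simp
  | insert a E ha ih =>
    rw [Finset.sum_powerset_insert ha, ← Finset.sum_add_distrib, Finset.card_insert_of_notMem ha,
      Finset.sum_insert ha]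
    have : ∀ t ∈ E.powerset,
        (∑ i ∈ insert a E, finsetSign t i * x i) ^ 4 +
          (∑ i ∈ insert a E, finsetSign (insert a t) i * x i) ^ 4 =
        2 * (∑ i ∈ E, finsetSign t i * x i) ^ 4 +
          12 * x a ^ 2 * (∑ i ∈ E, finsetSign t i * x i) ^ 2 + 2 * x a ^ 4 := by
      intro t ht
      obtain ⟨h1, h2⟩ := sum_finsetSign_insert ha (Finset.mem_powerset.1 ht) x
      simp only [smul_eq_mul] at h1 h2
      rw [h1, h2]
      ring
    rw [Finset.sum_congr rfl this, Finset.sum_add_distrib, Finset.sum_add_distrib,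
      ← Finset.mul_sum, ← Finset.mul_sum, sum_powerset_sq_finsetSign, Finset.sum_const,
      Finset.card_powerset, nsmul_eq_mul]
    have hpos : (0 : ℝ) ≤ 2 ^ E.card * x a ^ 4 := by positivity
    push_cast
    rw [pow_succ (2 : ℝ)]
    linear_combination 2 * ih + 4 * hpos

open scoped Classical in
/-- Anti-concentration of Rademacher sums: a fixed proportion of all sign patterns makes the
signed sum at least of the order of the `ℓ²`-norm. -/
lemma two_pow_card_le_card_finsetSign (E : Finset ι) (x : ι → ℝ) {r : ℝ} (hr : 0 < r)
    (h : r ≤ ∑ i ∈ E, x i ^ 2) :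
    (2 : ℝ) ^ E.card ≤ 11 * ∑ t ∈ E.powerset,
      if r / 2 ≤ (∑ i ∈ E, finsetSign t i * x i) ^ 2 then (1 : ℝ) else 0 := by
  set B := ∑ i ∈ E, x i ^ 2 with hB
  have hB0 : 0 < B := hr.trans_le h
  set R : Finset ι → ℝ := fun t => ∑ i ∈ E, finsetSign t i * x i with hR
  have h2 : ∑ t ∈ E.powerset, R t ^ 2 = 2 ^ E.card * B := sum_powerset_sq_finsetSign E x
  have h4 : ∑ t ∈ E.powerset, R t ^ 4 ≤ 2 ^ E.card * (3 * B ^ 2) :=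
    sum_powerset_pow_four_finsetSign_le E x
  have hlow : 2 ^ E.card * B ^ 2 ≤
      ∑ t ∈ E.powerset, (R t ^ 2 - B / 2) * (7 * B - R t ^ 2) := by
    have : ∀ t ∈ E.powerset, (R t ^ 2 - B / 2) * (7 * B - R t ^ 2) =
        15 / 2 * B * R t ^ 2 - R t ^ 4 - 7 / 2 * B ^ 2 := fun t _ => by ring
    rw [Finset.sum_congr rfl this, Finset.sum_sub_distrib, Finset.sum_sub_distrib,
      ← Finset.mul_sum, h2, Finset.sum_const, Finset.card_powerset, nsmul_eq_mul]
    push_cast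
    nlinarith
  have hup : ∑ t ∈ E.powerset, (R t ^ 2 - B / 2) * (7 * B - R t ^ 2) ≤
      ∑ t ∈ E.powerset, 11 * B ^ 2 * (if r / 2 ≤ R t ^ 2 then (1 : ℝ) else 0) := by
    refine Finset.sum_le_sum fun t _ => ?_
    split_ifs with hc
    · nlinarith [sq_nonneg (R t ^ 2 - 15 / 4 * B), sq_nonneg B]
    · push Not at hc
      nlinarith
  rw [← Finset.mul_sum] at hup
  have := hlow.trans hup
  refine le_of_mul_le_mul_right ?_ (pow_pos hB0 2)
  linarith

end RandomSigns

section Minlos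

variable {V : Type*} [AddCommGroup V] [Module ℝ V]

/-- Sazonov-type estimate: if the linear combinations of the random variables `x e` are small
in probability whenever the corresponding vector is small for `p`, then the `ℓ²`-norm of the
`x e` is controlled by the trace `∑ p(e)²`. -/
lemma measureReal_le_sum_sq_le {Ω : Type*} [MeasurableSpace Ω] (μ : Measure Ω)
    [IsProbabilityMeasure μ] (p : HilbSeminorm V) (E : Finset V) (x : V → Ω → ℝ)
    (hx : ∀ e, Measurable (x e)) {δ ε r : ℝ} (hδ : 0 < δ) (hε : 0 ≤ ε) (hr : 0 < r)
    (h : ∀ c : V → ℝ, p.toFun (∑ e ∈ E, c e • e) ≤ δ →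
      μ.real {ω | 1 ≤ |∑ e ∈ E, c e * x e ω|} ≤ ε) :
    μ.real {ω | r ^ 2 ≤ ∑ e ∈ E, x e ω ^ 2} ≤
      11 * (ε + 2 / (r * δ) ^ 2 * ∑ e ∈ E, p.bilin e e) := by
  classical
  set R : Finset V → Ω → ℝ := fun t ω => ∑ e ∈ E, finsetSign t e * x e ω with hR
  have hRm (t) : Measurable (R t) := by fun_prop
  set D : Finset V → Set Ω := fun t => {ω | r ^ 2 / 2 ≤ R t ω ^ 2} with hD
  have hDm (t) : MeasurableSet (D t) := measurableSet_le measurable_const ((hRm t).pow_const 2)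
  set G : Set Ω := {ω | r ^ 2 ≤ ∑ e ∈ E, x e ω ^ 2} with hG
  have hGm : MeasurableSet G := measurableSet_le measurable_const (by fun_prop)
  have hDt (t : Finset V) : μ.real (D t) ≤ ε + 2 / (r * δ) ^ 2 *
      p.bilin (∑ e ∈ E, finsetSign t e • e) (∑ e ∈ E, finsetSign t e • e) := by
    set v := ∑ e ∈ E, finsetSign t e • e with hv
    by_cases hp : Real.sqrt 2 / r * p.toFun v ≤ δ
    · have h1 := h (fun e => Real.sqrt 2 / r * finsetSign t e) (by
        simp only [mul_smul, ← Finset.smul_sum]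
        rwa [p.toFun_smul, abs_of_pos (by positivity)])
      have h2 : D t ⊆ {ω | 1 ≤ |∑ e ∈ E, Real.sqrt 2 / r * finsetSign t e * x e ω|} := by
        intro ω hω
        simp only [Set.mem_ofPred_eq, mul_assoc, ← Finset.mul_sum]
        rw [← one_le_sq_iff_one_le_abs, mul_pow, div_pow, Real.sq_sqrt zero_le_two]
        have hω' : r ^ 2 / 2 ≤ R t ω ^ 2 := hω
        rw [div_mul_eq_mul_div, one_le_div (by positivity)]
        linarith
      have h3 : 0 ≤ 2 / (r * δ) ^ 2 * p.bilin v v := mul_nonneg (by positivity) (p.nonneg v)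
      linarith [(measureReal_mono h2).trans h1]
    · push Not at hp
      have h1 : δ ^ 2 ≤ 2 / r ^ 2 * p.bilin v v := by
        have := pow_le_pow_left₀ hδ.le hp.le 2
        rwa [mul_pow, div_pow, Real.sq_sqrt zero_le_two, p.sq_toFun] at this
      have h2 : 1 ≤ 2 / (r * δ) ^ 2 * p.bilin v v := by
        have h3 : 2 / (r * δ) ^ 2 * p.bilin v v = 2 / r ^ 2 * p.bilin v v / δ ^ 2 := by
          field_simp
        rw [h3, one_le_div (by positivity)]
        exact h1
      linarith [measureReal_le_one (μ := μ) (s := D t)]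
  have hint (t) : Integrable ((D t).indicator fun _ => (1 : ℝ)) μ :=
    (integrable_const 1).indicator (hDm t)
  have hkey : 2 ^ E.card * μ.real G ≤ 11 * ∑ t ∈ E.powerset, μ.real (D t) := by
    have h1 : ∫ ω, 2 ^ E.card * G.indicator (fun _ => (1 : ℝ)) ω ∂μ ≤
        ∫ ω, 11 * ∑ t ∈ E.powerset, (D t).indicator (fun _ => (1 : ℝ)) ω ∂μ := by
      refine integral_mono (((integrable_const 1).indicator hGm).const_mul _)
        ((integrable_finsetSum _ fun t _ => hint t).const_mul _) fun ω => ?_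
      by_cases hω : ω ∈ G
      · have := two_pow_card_le_card_finsetSign E (fun e => x e ω) (pow_pos hr 2) hω
        simpa [Set.indicator_apply, hω, hD, hR] using this
      · simp only [Set.indicator_of_notMem hω, mul_zero]
        exact mul_nonneg (by norm_num)
          (Finset.sum_nonneg fun t _ => Set.indicator_nonneg (fun _ _ => zero_le_one) _)
    rw [integral_const_mul, integral_const_mul, integral_finsetSum _ fun t _ => hint t] at h1
    simpa [integral_indicator, hGm, hDm] using h1
  have hsum : ∑ t ∈ E.powerset, μ.real (D t) ≤
      2 ^ E.card * (ε + 2 / (r * δ) ^ 2 * ∑ e ∈ E, p.bilin e e) := by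
    refine (Finset.sum_le_sum fun t _ => hDt t).trans_eq ?_
    rw [Finset.sum_add_distrib, ← Finset.mul_sum,
      sum_powerset_bilin_finsetSign p.bilin E fun e => e, Finset.sum_const,
      Finset.card_powerset, nsmul_eq_mul]
    push_cast
    ring
  refine le_of_mul_le_mul_left ?_ (pow_pos (zero_lt_two (α := ℝ)) E.card)
  linarith

end Minlos

namespace Character

variable {A : Type*} [CommRing A] [Algebra ℝ A]

open scoped Classical in
/-- The extension by zero of a character of a subalgebra. -/
noncomputable def extendZero (S : Subalgebra ℝ A) (α : Character S) (a : A) : ℝ :=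
  if h : a ∈ S then α ⟨a, h⟩ else 0

lemma extendZero_of_mem {S : Subalgebra ℝ A} (α : Character S) {a : A} (h : a ∈ S) :
    extendZero S α a = α ⟨a, h⟩ := dif_pos h

lemma continuous_extendZero (S : Subalgebra ℝ A) (a : A) :
    Continuous fun α : Character S => extendZero S α a := by
  by_cases h : a ∈ S
  · simpa only [extendZero_of_mem _ h] using continuous_eval _
  · simpa only [extendZero, h, dite_false] using continuous_const

lemma exists_linearMap_eq_extendZero {S : Subalgebra ℝ A} (α : Character S) :
    ∃ g : A →ₗ[ℝ] ℝ, ∀ a ∈ S, extendZero S α a = g a := by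
  obtain ⟨g, hg⟩ := LinearMap.exists_extend (p := S.toSubmodule) α.toLinearMap
  refine ⟨g, fun a ha => ?_⟩
  rw [extendZero_of_mem α ha]
  exact (LinearMap.congr_fun hg ⟨a, ha⟩).symm

lemma extendZero_sum {S : Subalgebra ℝ A} (α : Character S) {V : Submodule ℝ A}
    {E : Finset V} (hE : ∀ e ∈ E, (e : A) ∈ S) (c : V → ℝ) :
    extendZero S α ((∑ e ∈ E, c e • e : V) : A) = ∑ e ∈ E, c e * extendZero S α e := by
  obtain ⟨g, hg⟩ := exists_linearMap_eq_extendZero α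
  have hmem : ((∑ e ∈ E, c e • e : V) : A) ∈ S := by
    rw [Submodule.coe_sum]
    exact sum_mem fun e he => S.smul_mem (hE e he) _
  rw [hg _ hmem]
  simp only [Submodule.coe_sum, Submodule.coe_smul, map_sum, map_smul, smul_eq_mul]
  exact Finset.sum_congr rfl fun e he => by rw [hg _ (hE e he)]

/-- For a concentrated family of measures, all but a small mass sits, uniformly over the finitely
generated subalgebras, on characters dominated by a fixed multiple of `q`. -/
lemma exists_nat_measure_le_of_concentrated {V : Submodule ℝ A} {p q : HilbSeminorm ↥V}
    (hpq : p.trace q < ⊤) {J : Set (Subalgebra ℝ A)}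
    {ν : ∀ S : Subalgebra ℝ A, Measure (Character ↥S)}
    (hν : ∀ S ∈ J, IsProbabilityMeasure (ν S)) (hconc : Concentrated V J p.toFun ν)
    {ε : ℝ} (hε : 0 < ε) :
    ∃ n : ℕ, ∀ S ∈ J, ∀ F : Finset V, (∀ v ∈ F, (v : A) ∈ S) →
      ν S {α | ¬ ∀ v ∈ F, |extendZero S α v| ≤ n * q.toFun v} ≤ ENNReal.ofReal ε := by
  obtain ⟨hker, t, ht0, ht⟩ := HilbSeminorm.trace_lt_top hpq
  obtain ⟨δ, hδ, hδc⟩ := hconc (ε / 22) (by positivity)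
  obtain ⟨n, hn⟩ := exists_nat_gt (44 * t / (δ ^ 2 * ε) + 1)
  have hn1 : (1 : ℝ) < n := by
    have : 0 ≤ 44 * t / (δ ^ 2 * ε) := by positivity
    linarith
  refine ⟨n, fun S hS F hF => ?_⟩
  have := hν S hS
  obtain ⟨E, hE, hEF, hEk⟩ := q.exists_isONS F
  have hES : ∀ e ∈ E, (e : A) ∈ S := by
    have : Submodule.span ℝ (F : Set V) ≤ S.toSubmodule.comap V.subtype :=
      Submodule.span_le.2 fun v hv => hF v hv
    exact fun e he => this (hEF he)
  have hconv (v : V) (hv : (v : A) ∈ S) {δ' ε' : ℝ} (h : ∀ S ∈ J, ∀ v : V, ∀ hv : (v : A) ∈ S,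
      p.toFun v ≤ δ' → ν S {α : Character ↥S | 1 ≤ |α ⟨(v : A), hv⟩|} ≤ ENNReal.ofReal ε')
      (hp : p.toFun v ≤ δ') : ν S {α | 1 ≤ |extendZero S α v|} ≤ ENNReal.ofReal ε' := by
    simp only [extendZero_of_mem _ hv]
    exact h S hS v hv hp
  have hkernel (k : V) (hkS : (k : A) ∈ S) (hk : k ∈ q.ker) :
      ∀ᵐ α ∂(ν S), extendZero S α k = 0 := by
    have h1 (m : ℕ) : ∀ᵐ α ∂(ν S), ¬ 1 ≤ |extendZero S α (((m : ℝ) • k : V) : A)| := by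
      rw [ae_iff]
      simp only [not_not]
      refine le_antisymm (ENNReal.le_of_forall_pos_le_add fun η hη _ => ?_) zero_le
      obtain ⟨δ', hδ', hc⟩ := hconc η (NNReal.coe_pos.2 hη)
      have hp0 : p.toFun ((m : ℝ) • k) ≤ δ' := by
        rw [p.toFun_smul, HilbSeminorm.toFun, hker k hk, Real.sqrt_zero, mul_zero]
        exact hδ'.le
      rw [zero_add, ← ENNReal.ofReal_coe_nnreal]
      exact hconv _ (S.smul_mem hkS (m : ℝ)) hc hp0
    filter_upwards [ae_all_iff.2 h1] with α hα
    obtain ⟨g, hg⟩ := exists_linearMap_eq_extendZero α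
    by_contra hne
    obtain ⟨m, hm⟩ := exists_nat_ge (1 / |extendZero S α k|)
    refine hα m ?_
    rw [Submodule.coe_smul, hg _ (S.smul_mem hkS (m : ℝ)), map_smul, ← hg _ hkS, smul_eq_mul,
      abs_mul, Nat.abs_cast]
    rwa [div_le_iff₀ (abs_pos.2 hne)] at hm
  have hproj (v : V) (hv : (v : A) ∈ S) :
      ((∑ e ∈ E, q.bilin v e • e : V) : A) ∈ S := by
    rw [Submodule.coe_sum]
    exact sum_mem fun e he => S.smul_mem (hES e he) _
  have hexp : ∀ᵐ α ∂(ν S), ∀ v ∈ F,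
      extendZero S α v = ∑ e ∈ E, q.bilin v e * extendZero S α e := by
    rw [eventually_all_finset]
    intro v hv
    filter_upwards [hkernel _ (S.sub_mem (hF v hv) (hproj v (hF v hv))) (hEk v hv)] with α hα
    obtain ⟨g, hg⟩ := exists_linearMap_eq_extendZero α
    rw [← extendZero_sum α hES, hg _ (hF v hv), hg _ (hproj v (hF v hv))]
    rw [Submodule.coe_sub, hg _ (S.sub_mem (hF v hv) (hproj v (hF v hv))), map_sub] at hα
    exact sub_eq_zero.1 hα
  have hmain := measureReal_le_sum_sq_le (ν S) p E (fun v α => extendZero S α v)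
    (fun v => (continuous_extendZero S v).measurable) hδ (ε := ε / 22) (by positivity)
    (r := n) (by positivity) (fun c hc => by
      simp only [← extendZero_sum _ hES]
      refine ENNReal.toReal_le_of_le_ofReal (by positivity) (hconv _ ?_ hδc hc)
      rw [Submodule.coe_sum]
      exact sum_mem fun e he => S.smul_mem (hES e he) _)
  have hbound : 11 * (ε / 22 + 2 / ((n : ℝ) * δ) ^ 2 * ∑ e ∈ E, p.bilin e e) ≤ ε := by
    have h1 : 2 / ((n : ℝ) * δ) ^ 2 * ∑ e ∈ E, p.bilin e e ≤ 2 / ((n : ℝ) * δ) ^ 2 * t :=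
      mul_le_mul_of_nonneg_left (ht E hE) (by positivity)
    have h2 : 2 / ((n : ℝ) * δ) ^ 2 * t ≤ ε / 22 := by
      rw [div_mul_eq_mul_div, div_le_iff₀ (by positivity)]
      have h3 : 44 * t / (δ ^ 2 * ε) ≤ n := by linarith
      rw [div_le_iff₀ (by positivity)] at h3
      have h4 : (n : ℝ) * (δ ^ 2 * ε) ≤ (n : ℝ) ^ 2 * (δ ^ 2 * ε) := by
        gcongr
        nlinarith
      nlinarith
    linarith
  have hle : ν S {α | (n : ℝ) ^ 2 ≤ ∑ e ∈ E, extendZero S α e ^ 2} ≤ ENNReal.ofReal ε :=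
    (ENNReal.le_ofReal_iff_toReal_le (measure_ne_top _ _) hε.le).2 (hmain.trans hbound)
  refine le_trans (measure_mono_ae ?_) hle
  filter_upwards [hexp] with α hα hnot
  by_contra hlt
  refine hnot fun v hv => ?_
  have hlt' : ∑ e ∈ E, extendZero S α e ^ 2 ≤ (n : ℝ) ^ 2 := (not_le.1 hlt).le
  rw [hα v hv]
  refine abs_le_of_sq_le_sq ?_ (mul_nonneg (Nat.cast_nonneg n) (q.toFun_nonneg v))
  calc (∑ e ∈ E, q.bilin v e * extendZero S α e) ^ 2
      ≤ (∑ e ∈ E, q.bilin v e ^ 2) * ∑ e ∈ E, extendZero S α e ^ 2 :=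
        Finset.sum_mul_sq_le_sq_mul_sq _ _ _
    _ ≤ q.toFun v ^ 2 * (n : ℝ) ^ 2 := by
        gcongr
        exact HilbSeminorm.sum_sq_bilin_le hE v
    _ = (n * q.toFun v) ^ 2 := by ring

end Character

/-- If probability measures on a compact space asymptotically concentrate on a sequence of compact
sets, then they have a regular limit carried by the union of these sets. -/
lemma exists_regular_limit_of_concentrated {Y : Type*} [TopologicalSpace Y] [CompactSpace Y]
    [T2Space Y] [MeasurableSpace Y] [BorelSpace Y] {ι : Type*} (U : Ultrafilter ι)
    (μ : ι → Measure Y) [∀ i, IsProbabilityMeasure (μ i)] {D : ℕ → Set Y}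
    (hD : ∀ n, IsCompact (D n))
    (hμD : ∀ ε : ℝ, 0 < ε → ∃ n, ∀ O, IsOpen O → D n ⊆ O →
      ∀ᶠ i in (U : Filter ι), (μ i) Oᶜ ≤ ENNReal.ofReal ε) :
    ∃ μ' : Measure Y, μ'.Regular ∧ IsProbabilityMeasure μ' ∧ μ' (⋃ n, D n)ᶜ = 0 ∧
      ∀ f : C(Y, ℝ), Tendsto (fun i => ∫ y, f y ∂(μ i)) U (𝓝 (∫ y, f y ∂μ')) := by
  let P : ι → ProbabilityMeasure Y := fun i => ⟨μ i, inferInstance⟩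
  obtain ⟨μ₀, -, hμ₀⟩ := isCompact_univ.ultrafilter_le_nhds (U.map P) (by simp)
  have hμ₀ : Tendsto P U (𝓝 μ₀) := hμ₀
  rw [ProbabilityMeasure.tendsto_iff_forall_integral_tendsto] at hμ₀
  obtain ⟨μ', hreg, hfin, hint⟩ :=
    Measure.exists_regular_eq_of_compactSpace (μ₀ : Measure Y)
  have hlim (f : C(Y, ℝ)) : Tendsto (fun i => ∫ y, f y ∂(μ i)) U (𝓝 (∫ y, f y ∂μ')) := by
    have := hμ₀ (BoundedContinuousFunction.mkOfCompact f)
    rwa [hint] at this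
  have hprob : IsProbabilityMeasure μ' := by
    have := hint (BoundedContinuousFunction.const Y 1)
    simp only [BoundedContinuousFunction.const_apply, integral_const, smul_eq_mul, mul_one,
      probReal_univ] at this
    exact ⟨by rw [← ENNReal.toReal_eq_one_iff]; exact this.symm⟩
  refine ⟨μ', hreg, hprob, ?_, hlim⟩
  refine le_antisymm (ENNReal.le_of_forall_pos_le_add fun η hη _ => ?_) zero_le
  rw [zero_add, ← ENNReal.ofReal_coe_nnreal]
  have hη' : (0 : ℝ) < η := NNReal.coe_pos.2 hη
  obtain ⟨n, hn⟩ := hμD (η / 2) (by positivity)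
  have hopen (O : Set Y) (hO : IsOpen O) (hDO : D n ⊆ O) : 1 - (η : ℝ) / 2 ≤ μ'.real O := by
    obtain ⟨O', hO', hDO', hcl⟩ := normal_exists_closure_subset (hD n).isClosed hO hDO
    obtain ⟨f, hf0, hf1, hf⟩ := exists_continuous_zero_one_of_isClosed hO.isClosed_compl
      isClosed_closure (Set.disjoint_compl_left_iff_subset.2 hcl)
    have hfint (m : Measure Y) [IsFiniteMeasure m] : Integrable f m :=
      (BoundedContinuousFunction.mkOfCompact f).integrable m
    have h1 : 1 - (η : ℝ) / 2 ≤ ∫ y, f y ∂μ' := by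
      refine ge_of_tendsto (hlim f) ?_
      filter_upwards [hn O' hO' hDO'] with i hi
      have h2 : (μ i).real O'ᶜ ≤ η / 2 := ENNReal.toReal_le_of_le_ofReal (by positivity) hi
      rw [probReal_compl_eq_one_sub hO'.measurableSet] at h2
      calc 1 - (η : ℝ) / 2 ≤ (μ i).real O' := by linarith
        _ = ∫ y, O'.indicator 1 y ∂(μ i) := (integral_indicator_one hO'.measurableSet).symm
        _ ≤ ∫ y, f y ∂(μ i) := by
            refine integral_mono ((integrable_const 1).indicator hO'.measurableSet) (hfint _) ?_
            intro y
            by_cases hy : y ∈ O'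
            · simp [hy, hf1 (subset_closure hy)]
            · simpa [hy] using (hf y).1
    refine h1.trans ?_
    calc ∫ y, f y ∂μ' ≤ ∫ y, O.indicator 1 y ∂μ' := by
            refine integral_mono (hfint _) ((integrable_const 1).indicator hO.measurableSet) ?_
            intro y
            by_cases hy : y ∈ O
            · simpa [hy] using (hf y).2
            · simp [hy, hf0 hy]
      _ = μ'.real O := integral_indicator_one hO.measurableSet
  obtain ⟨O, hDO, hO, hOle⟩ := (D n).exists_isOpen_le_add μ'
    (ε := ENNReal.ofReal (η / 2)) (by positivity)
  have hreal : μ'.real O ≤ μ'.real (D n) + η / 2 := by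
    have := ENNReal.toReal_mono (by finiteness) hOle
    rwa [ENNReal.toReal_add (by finiteness) (by finiteness),
      ENNReal.toReal_ofReal (by positivity)] at this
  have hDn : 1 - (η : ℝ) ≤ μ'.real (D n) := by linarith [hopen O hO hDO]
  refine (measure_mono (Set.compl_subset_compl.2 (Set.subset_iUnion D n))).trans ?_
  rw [ENNReal.le_ofReal_iff_toReal_le (measure_ne_top _ _) hη'.le]
  change μ'.real (D n)ᶜ ≤ η
  rw [probReal_compl_eq_one_sub (hD n).isClosed.measurableSet]
  linarith

/-- A regular measure on a compact space carried by countably many embedded compact subsets of a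
space `X` is the image of a Radon measure on `X`. -/
lemma exists_isRadonMeasure_map_eq {X Y : Type*} [TopologicalSpace X] [MeasurableSpace X]
    [BorelSpace X] [Nonempty X] [TopologicalSpace Y] [T2Space Y] [MeasurableSpace Y]
    [BorelSpace Y] {j : X → Y} (hj : IsEmbedding j) {T : ℕ → Set X} (hT : ∀ n, IsCompact (T n))
    (hmono : Monotone T) (μ : Measure Y) [μ.Regular] [IsFiniteMeasure μ]
    (hμ : μ (⋃ n, j '' T n)ᶜ = 0) :
    ∃ ν : Measure X, IsRadonMeasure ν ∧ ν.map j = μ ∧ ν (⋃ n, T n)ᶜ = 0 := by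
  classical
  set D : Set Y := ⋃ n, j '' T n with hDdef
  have hDc (n : ℕ) : IsCompact (j '' T n) := (hT n).image hj.continuous
  have hDm : MeasurableSet D := MeasurableSet.iUnion fun n => (hDc n).isClosed.measurableSet
  obtain ⟨x₀⟩ := ‹Nonempty X›
  let r : Y → X := fun y => if y ∈ D then Function.invFun j y else x₀
  have : Nonempty X := ⟨x₀⟩
  have hrj (x : X) (hx : j x ∈ D) : r (j x) = x := by
    simp only [r, if_pos hx, Function.leftInverse_invFun hj.injective x]
  have hDr : D ⊆ Set.range j := Set.iUnion_subset fun n => Set.image_subset_range _ _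
  have hjr (y : Y) (hy : y ∈ D) : j (r y) = y := by
    obtain ⟨x, rfl⟩ := hDr hy
    rw [hrj x hy]
  have hr : Measurable r := by
    refine measurable_of_isOpen fun G hG => ?_
    obtain ⟨O, hO, rfl⟩ := hj.isInducing.isOpen_iff.1 hG
    have hD' : r ⁻¹' (j ⁻¹' O) = D ∩ O ∪ Dᶜ ∩ {_y | x₀ ∈ j ⁻¹' O} := by
      ext y
      by_cases hy : y ∈ D
      · simp [hy, hjr y hy]
      · simp [hy, r]
    rw [hD']
    exact (hDm.inter hO.measurableSet).union (hDm.compl.inter (MeasurableSet.const _))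
  have hae : ∀ᵐ y ∂μ, y ∈ D := hμ
  refine ⟨μ.map r, ⟨inferInstance, ?_⟩, ?_, ?_⟩
  · intro B hB s hs
    rw [Measure.map_apply hr hB] at hs
    have hB' : MeasurableSet (r ⁻¹' B) := hr hB
    have hun : μ (r ⁻¹' B) = ⨆ n, μ (r ⁻¹' B ∩ j '' T n) := by
      rw [← measure_inter_add_sdiff (r ⁻¹' B) hDm,
        measure_mono_null (fun y hy => hy.2 : r ⁻¹' B \ D ⊆ Dᶜ) hμ, add_zero, hDdef,
        Set.inter_iUnion]
      exact Monotone.measure_iUnion fun m n hmn =>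
        Set.inter_subset_inter_right _ (Set.image_mono (hmono hmn))
    rw [hun] at hs
    obtain ⟨n, hn⟩ := lt_iSup_iff.1 hs
    obtain ⟨K, hKB, hK, hsK⟩ := (hB'.inter
      (hDc n).isClosed.measurableSet).exists_lt_isCompact_of_ne_top (by finiteness) hn
    have hKD : K ⊆ D := fun y hy => Set.mem_iUnion.2 ⟨n, (hKB hy).2⟩
    have hjK : IsCompact (j ⁻¹' K) :=
      (hj.isInducing.isCompact_preimage_iff (hKD.trans hDr)).2 hK
    have hrK : r '' K = j ⁻¹' K := by
      ext x
      constructor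
      · rintro ⟨y, hy, rfl⟩
        rw [Set.mem_preimage, hjr y (hKD hy)]
        exact hy
      · intro hx
        exact ⟨j x, hx, hrj x (hKD hx)⟩
    refine ⟨j ⁻¹' K, ?_, hjK, hsK.trans_le ?_⟩
    · rw [← hrK]
      rintro _ ⟨y, hy, rfl⟩
      exact (hKB hy).1
    · rw [Measure.map_apply hr (hj.continuous.measurable hK.isClosed.measurableSet)]
      refine measure_mono fun y hy => ?_
      rw [Set.mem_preimage, Set.mem_preimage, hjr y (hKD hy)]
      exact hy
  · rw [Measure.map_map hj.continuous.measurable hr]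
    conv_rhs => rw [← Measure.map_id (μ := μ)]
    exact Measure.map_congr (hae.mono fun y hy => hjr y hy)
  · have hTm : (⋃ n, T n) = j ⁻¹' D := by
      rw [hDdef, Set.preimage_iUnion]
      simp only [Set.preimage_image_eq _ hj.injective]
    rw [hTm, ← Set.preimage_compl,
      Measure.map_apply hr (hj.continuous.measurable hDm.compl)]
    refine measure_mono_null (fun y hy => ?_) hμ
    by_contra hyD
    rw [Set.notMem_compl_iff] at hyD
    rw [Set.mem_preimage, Set.mem_preimage, hjr y hyD] at hy
    exact hy hyD

/-- The truncation of an extended real number to the interval `[-M, M]`. -/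
noncomputable def erealClip (M : ℝ) : C(EReal, ℝ) where
  toFun y := (max ((-M : ℝ) : EReal) (min (M : EReal) y)).toReal
  continuous_toFun := by
    refine EReal.continuousOn_toReal.comp_continuous (by fun_prop) fun y => ?_
    simp only [Set.mem_compl_iff, Set.mem_insert_iff, Set.mem_singleton_iff, not_or]
    constructor
    · exact (lt_max_of_lt_left (EReal.bot_lt_coe _)).ne'
    · exact (max_lt (EReal.coe_lt_top _) (min_lt_of_left_lt (EReal.coe_lt_top _))).ne

lemma erealClip_coe (M x : ℝ) : erealClip M (x : EReal) = max (-M) (min M x) := by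
  change (max ((-M : ℝ) : EReal) (min (M : EReal) (x : EReal))).toReal = _
  rw [← EReal.coe_strictMono.monotone.map_min, ← EReal.coe_strictMono.monotone.map_max,
    EReal.toReal_coe]

lemma abs_erealClip_coe_le {M : ℝ} (hM : 0 ≤ M) (x : ℝ) : |erealClip M (x : EReal)| ≤ |x| := by
  rw [erealClip_coe]
  rcases le_total 0 x with h | h
  · rw [max_eq_right (by linarith [le_min hM h]), abs_of_nonneg h, abs_of_nonneg (le_min hM h)]
    exact min_le_right _ _
  · rw [min_eq_right (h.trans hM), abs_of_nonpos h, abs_of_nonpos (max_le (by linarith) h)]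
    linarith [le_max_right (-M) x]

lemma abs_erealClip_coe_sub_le {M : ℝ} (hM : 0 < M) (x : ℝ) :
    |erealClip M (x : EReal) - x| ≤ x ^ 2 / M := by
  rw [erealClip_coe, le_div_iff₀ hM]
  rcases le_total x M with h | h
  · rw [min_eq_right h]
    rcases le_total (-M) x with h' | h'
    · rw [max_eq_right h', sub_self, abs_zero, zero_mul]
      positivity
    · rw [max_eq_left h', abs_of_nonneg (by linarith)]
      nlinarith
  · rw [min_eq_left h, max_eq_right (by linarith), abs_of_nonpos (by linarith)]
    nlinarith

lemma tendsto_erealClip_coe (x : ℝ) :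
    Tendsto (fun M : ℕ => erealClip (M + 1) (x : EReal)) atTop (𝓝 x) := by
  refine tendsto_iff_norm_sub_tendsto_zero.2 ?_
  refine squeeze_zero (fun _ => norm_nonneg _)
    (fun M : ℕ => abs_erealClip_coe_sub_le (M := (M : ℝ) + 1) (by positivity) x) ?_
  exact tendsto_const_nhds.div_atTop
    (tendsto_atTop_add_const_right _ _ tendsto_natCast_atTop_atTop)

lemma aestronglyMeasurable_comp_coe (f : C(EReal, ℝ)) {Ω : Type*} [MeasurableSpace Ω]
    {X : Ω → ℝ} {P : Measure Ω} (hX : AEStronglyMeasurable X P) :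
    AEStronglyMeasurable (fun ω => f (X ω)) P :=
  (f.continuous.comp continuous_coe_real_ereal).comp_aestronglyMeasurable hX

lemma integrable_comp_coe (f : C(EReal, ℝ)) {Ω : Type*} [MeasurableSpace Ω]
    {X : Ω → ℝ} {P : Measure Ω} [IsFiniteMeasure P] (hX : AEStronglyMeasurable X P) :
    Integrable (fun ω => f (X ω)) P :=
  Integrable.of_bound (aestronglyMeasurable_comp_coe f hX) ‖f‖
    (Eventually.of_forall fun _ => f.norm_coe_le_norm _)

/-- Convergence in distribution, together with a common second moment, gives convergence of the
means. -/
lemma integral_eq_of_tendsto_of_sq {ι : Type*} (U : Filter ι) [U.NeBot] {Ω : ι → Type*}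
    [∀ i, MeasurableSpace (Ω i)] (P : ∀ i, Measure (Ω i)) [∀ i, IsProbabilityMeasure (P i)]
    (X : ∀ i, Ω i → ℝ) {Ω' : Type*} [MeasurableSpace Ω'] (ν : Measure Ω')
    [IsProbabilityMeasure ν] {Z : Ω' → ℝ} (hZ : Measurable Z) {m s : ℝ}
    (hint : ∀ᶠ i in U, Integrable (X i) (P i) ∧ Integrable (fun ω => X i ω ^ 2) (P i) ∧
      ∫ ω, X i ω ∂(P i) = m ∧ ∫ ω, X i ω ^ 2 ∂(P i) = s)
    (hlim : ∀ f : C(EReal, ℝ), Tendsto (fun i => ∫ ω, f (X i ω) ∂(P i)) U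
      (𝓝 (∫ ω, f (Z ω) ∂ν))) :
    ∫ ω, Z ω ∂ν = m := by
  have habs (M : ℕ) : ∫ ω, |erealClip (M + 1) (Z ω)| ∂ν ≤ 1 + s := by
    let f : C(EReal, ℝ) := |erealClip (M + 1)|
    refine le_of_tendsto (hlim f) ?_
    filter_upwards [hint] with i hi
    calc ∫ ω, f (X i ω) ∂(P i) ≤ ∫ ω, (1 + X i ω ^ 2) ∂(P i) := by
          refine integral_mono (integrable_comp_coe f hi.1.1) ((integrable_const 1).add hi.2.1)
            fun ω => ?_
          refine (abs_erealClip_coe_le (by positivity) (X i ω)).trans ?_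
          rw [← sq_abs (X i ω)]
          nlinarith [sq_nonneg (|X i ω| - 1), abs_nonneg (X i ω)]
      _ = 1 + s := by
          rw [integral_add (integrable_const 1) hi.2.1, hi.2.2.2]
          simp
  have hZint : Integrable Z ν := by
    refine ⟨hZ.aestronglyMeasurable, ?_⟩
    have hlimZ (ω : Ω') : ‖Z ω‖ₑ = liminf (fun M : ℕ => ‖erealClip (M + 1) (Z ω)‖ₑ) atTop :=
      (tendsto_erealClip_coe (Z ω)).enorm.liminf_eq.symm
    rw [HasFiniteIntegral]
    simp only [hlimZ]
    have hm (M : ℕ) : Measurable fun ω => ‖erealClip (M + 1) (Z ω : EReal)‖ₑ :=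
      ((erealClip (M + 1)).continuous.comp continuous_coe_real_ereal).enorm.measurable.comp hZ
    refine (lintegral_liminf_le hm).trans_lt ?_
    refine lt_of_le_of_lt (liminf_le_of_le (a := ENNReal.ofReal (1 + s))
      (by isBoundedDefault) fun b hb => ?_) ENNReal.ofReal_lt_top
    obtain ⟨M, hM⟩ := hb.exists
    refine hM.trans ?_
    rw [← ofReal_integral_norm_eq_lintegral_enorm
      (integrable_comp_coe (erealClip (M + 1)) hZ.aestronglyMeasurable)]
    exact ENNReal.ofReal_le_ofReal (habs M)
  have hconv : Tendsto (fun M : ℕ => ∫ ω, erealClip (M + 1) (Z ω) ∂ν) atTop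
      (𝓝 (∫ ω, Z ω ∂ν)) :=
    tendsto_integral_of_dominated_convergence (fun ω => |Z ω|)
      (fun M => aestronglyMeasurable_comp_coe _ hZ.aestronglyMeasurable) hZint.abs
      (fun M => Eventually.of_forall fun ω => abs_erealClip_coe_le (by positivity) _)
      (Eventually.of_forall fun ω => tendsto_erealClip_coe _)
  refine tendsto_nhds_unique hconv (tendsto_iff_norm_sub_tendsto_zero.2 ?_)
  refine squeeze_zero (fun _ => norm_nonneg _) (g := fun M : ℕ => s / ((M : ℝ) + 1))
    (fun M => ?_) (tendsto_const_nhds.div_atTop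
      (tendsto_atTop_add_const_right _ _ tendsto_natCast_atTop_atTop))
  refine le_of_tendsto ((hlim (erealClip (M + 1))).sub_const m).norm ?_
  filter_upwards [hint] with i hi
  rw [← hi.2.2.1, ← integral_sub (integrable_comp_coe _ hi.1.1) hi.1, ← hi.2.2.2, ← integral_div]
  exact norm_integral_le_of_norm_le (hi.2.1.div_const _)
    (Eventually.of_forall fun ω => abs_erealClip_coe_sub_le (by positivity) _)

namespace Character

variable {A : Type*} [CommRing A] [Algebra ℝ A]

/-- Functions on `A` which are asymptotically multiplicative, additive and bounded on generators
converge to a character along an ultrafilter. -/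
lemma exists_tendsto {ι : Type*} (U : Ultrafilter ι) {s : Set A} (hgen : Algebra.adjoin ℝ s = ⊤)
    (x : ι → A → ℝ)
    (hadd : ∀ a b, ∀ᶠ i in (U : Filter ι), x i (a + b) = x i a + x i b)
    (hmul : ∀ a b, ∀ᶠ i in (U : Filter ι), x i (a * b) = x i a * x i b)
    (halg : ∀ r : ℝ, ∀ᶠ i in (U : Filter ι), x i (algebraMap ℝ A r) = r)
    (hbdd : ∀ v ∈ s, ∃ C, ∀ᶠ i in (U : Filter ι), |x i v| ≤ C) :
    ∃ z : Character A, ∀ a, Tendsto (fun i => x i a) U (𝓝 (z a)) := by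
  have hb (a : A) : ∃ C, ∀ᶠ i in (U : Filter ι), |x i a| ≤ C := by
    have ha : a ∈ Algebra.adjoin ℝ s := by rw [hgen]; trivial
    induction ha using Algebra.adjoin_induction with
    | mem v hv => exact hbdd v hv
    | algebraMap r => exact ⟨|r|, (halg r).mono fun i hi => by rw [hi]⟩
    | add a b _ _ iha ihb =>
      obtain ⟨C, hC⟩ := iha
      obtain ⟨D, hD⟩ := ihb
      refine ⟨C + D, ?_⟩
      filter_upwards [hC, hD, hadd a b] with i h1 h2 h3
      rw [h3]
      exact (abs_add_le _ _).trans (add_le_add h1 h2)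
    | mul a b _ _ iha ihb =>
      obtain ⟨C, hC⟩ := iha
      obtain ⟨D, hD⟩ := ihb
      refine ⟨C * D, ?_⟩
      filter_upwards [hC, hD, hmul a b] with i h1 h2 h3
      rw [h3, abs_mul]
      exact mul_le_mul h1 h2 (abs_nonneg _) ((abs_nonneg _).trans h1)
  have hz (a : A) : ∃ y : ℝ, Tendsto (fun i => x i a) U (𝓝 y) := by
    obtain ⟨C, hC⟩ := hb a
    obtain ⟨y, -, hy⟩ := (isCompact_Icc (a := -C) (b := C)).ultrafilter_le_nhds
      (U.map fun i => x i a) (le_principal_iff.2 (hC.mono fun i hi => abs_le.1 hi))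
    exact ⟨y, hy⟩
  choose z hz using hz
  have hzalg (r : ℝ) : z (algebraMap ℝ A r) = r :=
    tendsto_nhds_unique (hz _) (tendsto_const_nhds.congr' ((halg r).mono fun i hi => hi.symm))
  exact ⟨{ toFun := z
           map_one' := by simpa using hzalg 1
           map_zero' := by simpa using hzalg 0
           map_add' := fun a b => tendsto_nhds_unique (hz _)
             (((hz a).add (hz b)).congr' ((hadd a b).mono fun i hi => hi.symm))
           map_mul' := fun a b => tendsto_nhds_unique (hz _)
             (((hz a).mul (hz b)).congr' ((hmul a b).mono fun i hi => hi.symm))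
           commutes' := hzalg }, hz⟩

lemma isCompact_charNonneg_inter_boundedOn {V : Submodule ℝ A}
    (hgen : Algebra.adjoin ℝ (V : Set A) = ⊤) (Q : Set A) (q : ↥V → ℝ) (C : ℝ) :
    IsCompact (charNonneg Q ∩ boundedOn V q C) := by
  rw [isCompact_iff_ultrafilter_le_nhds]
  intro U hU
  have hU' : ∀ᶠ α in (U : Filter (Character A)), α ∈ charNonneg Q ∩ boundedOn V q C :=
    le_principal_iff.1 hU
  obtain ⟨z, hz⟩ := exists_tendsto U hgen (fun (α : Character A) a => α a)
    (fun a b => by simp) (fun a b => by simp) (fun r => by simp)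
    (fun v hv => ⟨C * q ⟨v, hv⟩, hU'.mono fun α hα => hα.2 ⟨v, hv⟩⟩)
  refine ⟨z, ?_, ?_⟩
  · exact ((isClosed_charNonneg Q).inter (isClosed_boundedOn V q C)).mem_of_tendsto
      (isInducing_coe.tendsto_nhds_iff.2 (tendsto_pi_nhds.2 hz)) hU'
  · exact isInducing_coe.tendsto_nhds_iff.2 (tendsto_pi_nhds.2 hz)

end Character

namespace Character

/-- The compact space of all extended-real-valued functions on `A`, with its Borel σ-algebra. -/
def ERealFun (A : Type*) : Type _ := A → EReal

namespace ERealFun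

variable (A : Type*)

noncomputable instance : TopologicalSpace (ERealFun A) :=
  inferInstanceAs (TopologicalSpace (A → EReal))
instance : CompactSpace (ERealFun A) := inferInstanceAs (CompactSpace (A → EReal))
instance : T2Space (ERealFun A) := inferInstanceAs (T2Space (A → EReal))
noncomputable instance : MeasurableSpace (ERealFun A) := borel (ERealFun A)
instance : BorelSpace (ERealFun A) := ⟨rfl⟩

variable {A}

/-- The canonical map from real-valued to extended-real-valued functions. -/
def ofReal (x : A → ℝ) : ERealFun A := fun a => (x a : EReal)

lemma isEmbedding_ofReal : IsEmbedding (ofReal : (A → ℝ) → ERealFun A) :=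
  IsEmbedding.piMap fun _ => EReal.isEmbedding_coe

/-- Evaluation at a point. -/
def eval (a : A) : C(ERealFun A, EReal) where
  toFun y := y a
  continuous_toFun := continuous_apply a

end ERealFun

variable {A : Type*} [CommRing A] [Algebra ℝ A]

lemma isEmbedding_coe : IsEmbedding (fun (α : Character A) (a : A) => α a) :=
  ⟨isInducing_coe, DFunLike.coe_injective⟩

/-- The subalgebra generated by finitely many elements of `V`. -/
def adjoinFinset {V : Submodule ℝ A} (F : Finset V) : Subalgebra ℝ A :=
  Algebra.adjoin ℝ (Submodule.span ℝ (V.subtype '' F) : Submodule ℝ A)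

lemma adjoinFinset_mem {V : Submodule ℝ A} (F : Finset V) :
    adjoinFinset F ∈ finGenSubalgebras V := by
  refine ⟨_, Submodule.span_le.2 ?_,
    FiniteDimensional.span_of_finite ℝ (F.finite_toSet.image V.subtype), rfl⟩
  rintro _ ⟨v, -, rfl⟩
  exact v.2

lemma coe_mem_adjoinFinset {V : Submodule ℝ A} {F : Finset V} {v : V} (hv : v ∈ F) :
    (v : A) ∈ adjoinFinset F :=
  Algebra.subset_adjoin (Submodule.subset_span ⟨v, hv, rfl⟩)

lemma eventually_mem_adjoinFinset {V : Submodule ℝ A}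
    (hgen : Algebra.adjoin ℝ (V : Set A) = ⊤) (a : A) :
    ∀ᶠ F : Finset V in atTop, a ∈ adjoinFinset F := by
  have ha : a ∈ Algebra.adjoin ℝ (V : Set A) := by rw [hgen]; trivial
  induction ha using Algebra.adjoin_induction with
  | mem v hv =>
    filter_upwards [eventually_ge_atTop {(⟨v, hv⟩ : V)}] with F hF
    exact coe_mem_adjoinFinset (v := ⟨v, hv⟩) (Finset.singleton_subset_iff.1 hF)
  | algebraMap r => exact Eventually.of_forall fun F => (adjoinFinset F).algebraMap_mem r
  | add a b _ _ iha ihb => filter_upwards [iha, ihb] with F h1 h2 using add_mem h1 h2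
  | mul a b _ _ iha ihb => filter_upwards [iha, ihb] with F h1 h2 using mul_mem h1 h2

/-- Along an ultrafilter finer than `atTop`, characters of the finitely generated subalgebras which
are dominated by `C • q` and nonnegative on `Q` converge to a character of the same kind. -/
lemma exists_tendsto_extendZero {V : Submodule ℝ A} (hgen : Algebra.adjoin ℝ (V : Set A) = ⊤)
    (Q : Set A) (q : ↥V → ℝ) (C : ℝ) (U : Ultrafilter (Finset V))
    (hU : (U : Filter (Finset V)) ≤ atTop)
    (α : ∀ F : Finset V, Character (adjoinFinset F))
    (hα : ∀ᶠ F in (U : Filter (Finset V)),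
      (∀ v : V, v ∈ F → |extendZero (adjoinFinset F) (α F) v| ≤ C * q v) ∧
        α F ∈ charNonnegOn Q (adjoinFinset F)) :
    ∃ z ∈ charNonneg Q ∩ boundedOn V q C,
      ∀ a, Tendsto (fun F => extendZero (adjoinFinset F) (α F) a) U (𝓝 (z a)) := by
  have hmem (a : A) : ∀ᶠ F in (U : Filter (Finset V)), a ∈ adjoinFinset F :=
    hU (eventually_mem_adjoinFinset hgen a)
  have hbd (v : V) : ∀ᶠ F in (U : Filter (Finset V)),
      |extendZero (adjoinFinset F) (α F) v| ≤ C * q v := by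
    filter_upwards [hα, hU (eventually_ge_atTop {v})] with F hF hv
    exact hF.1 v (Finset.singleton_subset_iff.1 hv)
  obtain ⟨z, hz⟩ := exists_tendsto U hgen (fun F a => extendZero (adjoinFinset F) (α F) a)
    (fun a b => by
      filter_upwards [hmem a, hmem b] with F ha hb
      rw [extendZero_of_mem _ ha, extendZero_of_mem _ hb, extendZero_of_mem _ (add_mem ha hb),
        ← map_add]
      rfl)
    (fun a b => by
      filter_upwards [hmem a, hmem b] with F ha hb
      rw [extendZero_of_mem _ ha, extendZero_of_mem _ hb, extendZero_of_mem _ (mul_mem ha hb),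
        ← map_mul]
      rfl)
    (fun r => Eventually.of_forall fun F => by
      rw [extendZero_of_mem _ ((adjoinFinset F).algebraMap_mem r)]
      exact (α F).commutes r)
    (fun v hv => ⟨_, hbd ⟨v, hv⟩⟩)
  refine ⟨z, ⟨fun a ha => ?_, fun v => le_of_tendsto (hz v).abs (hbd v)⟩, hz⟩
  refine ge_of_tendsto (hz a) ?_
  filter_upwards [hmem a, hα] with F haF hF
  rw [extendZero_of_mem _ haF]
  exact hF.2 ⟨a, haF⟩ ha

/-- The map sending a character of a subalgebra to its extension by zero. -/
noncomputable def extendZeroEReal (S : Subalgebra ℝ A) (α : Character S) : ERealFun A :=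
  ERealFun.ofReal fun a => extendZero S α a

lemma continuous_extendZeroEReal (S : Subalgebra ℝ A) : Continuous (extendZeroEReal S) :=
  ERealFun.isEmbedding_ofReal.continuous.comp
    (continuous_pi fun a => continuous_extendZero S a)

/-- The map sending a character to the corresponding extended-real-valued function. -/
noncomputable def toERealFun (α : Character A) : ERealFun A := ERealFun.ofReal α

lemma isEmbedding_toERealFun : IsEmbedding (toERealFun : Character A → ERealFun A) :=
  ERealFun.isEmbedding_ofReal.comp isEmbedding_coe

lemma eventually_extendZeroEReal_mem {V : Submodule ℝ A}
    (hgen : Algebra.adjoin ℝ (V : Set A) = ⊤) [Nonempty (Character A)] (Q : Set A)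
    (q : ↥V → ℝ) (C : ℝ) (U : Ultrafilter (Finset V))
    (hU : (U : Filter (Finset V)) ≤ atTop)
    {O : Set (ERealFun A)} (hO : IsOpen O)
    (hsub : toERealFun '' (charNonneg Q ∩ boundedOn V q C) ⊆ O) :
    ∀ᶠ F in (U : Filter (Finset V)), ∀ α : Character (adjoinFinset F),
      (∀ v : V, v ∈ F → |extendZero (adjoinFinset F) α v| ≤ C * q v) →
        α ∈ charNonnegOn Q (adjoinFinset F) → extendZeroEReal (adjoinFinset F) α ∈ O := by
  by_contra hcon
  rw [← Ultrafilter.eventually_not] at hcon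
  obtain ⟨α₀⟩ := ‹Nonempty (Character A)›
  have hex (F : Finset V) : ∃ α : Character (adjoinFinset F),
      (¬ ∀ α : Character (adjoinFinset F),
        (∀ v : V, v ∈ F → |extendZero (adjoinFinset F) α v| ≤ C * q v) →
          α ∈ charNonnegOn Q (adjoinFinset F) → extendZeroEReal (adjoinFinset F) α ∈ O) →
      ((∀ v : V, v ∈ F → |extendZero (adjoinFinset F) α v| ≤ C * q v) ∧
        α ∈ charNonnegOn Q (adjoinFinset F)) ∧ extendZeroEReal (adjoinFinset F) α ∉ O := by
    by_cases h : ∀ α : Character (adjoinFinset F),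
        (∀ v : V, v ∈ F → |extendZero (adjoinFinset F) α v| ≤ C * q v) →
          α ∈ charNonnegOn Q (adjoinFinset F) → extendZeroEReal (adjoinFinset F) α ∈ O
    · exact ⟨α₀.comp (adjoinFinset F).val, fun h' => absurd h h'⟩
    · push Not at h
      obtain ⟨α, h1, h2, h3⟩ := h
      exact ⟨α, fun _ => ⟨⟨h1, h2⟩, h3⟩⟩
  choose α hα using hex
  have hα' := hcon.mono fun F hF => hα F hF
  obtain ⟨z, hzT, hz⟩ := exists_tendsto_extendZero hgen Q q C U hU α (hα'.mono fun F hF => hF.1)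
  have hlim : Tendsto (fun F => extendZeroEReal (adjoinFinset F) (α F)) U (𝓝 (toERealFun z)) :=
    (ERealFun.isEmbedding_ofReal.continuous.tendsto _).comp (tendsto_pi_nhds.2 hz)
  have hin := hlim.eventually (hO.mem_nhds (hsub ⟨z, hzT, rfl⟩))
  obtain ⟨F, hF1, hF2⟩ := (hin.and hα').exists
  exact hF2.2 hF1

/-- A concentrated family of representing measures on the finitely generated subalgebras glues to
a representing Radon measure carried by the `q`-continuous characters nonnegative on `Q`. -/
theorem exists_representing_of_concentrated (V : Submodule ℝ A)
    (hgen : Algebra.adjoin ℝ (V : Set A) = ⊤) (Q : Set A) (q : HilbSeminorm ↥V)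
    [Nonempty (Character A)] (L : A →ₗ[ℝ] ℝ) (hL1 : L 1 = 1)
    {p : HilbSeminorm ↥V} (hpq : p.trace q < ⊤)
    (ν : ∀ S : Subalgebra ℝ A, Measure (Character ↥S))
    (hL : ∀ S ∈ finGenSubalgebras V, ∀ a : S, L (a : A) = ∫ α : Character ↥S, α a ∂(ν S))
    (hQ : ∀ S ∈ finGenSubalgebras V, ν S {α : Character ↥S | α ∉ charNonnegOn Q S} = 0)
    (hconc : Concentrated V (finGenSubalgebras V) p.toFun ν) :
    ∃ μ : Measure (Character A), IsRadonMeasure μ ∧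
      (∀ a : A, L a = ∫ α : Character A, α a ∂μ) ∧
      μ {α : Character A | ¬ (α ∈ charNonneg Q ∧ QContOn V q.toFun α)} = 0 := by
  have hL' (S : Subalgebra ℝ A) (hS : S ∈ finGenSubalgebras V) (a : S) :
      (L ∘ₗ S.val.toLinearMap) a = ∫ α : Character ↥S, α a ∂(ν S) := hL S hS a
  have hprob (S : Subalgebra ℝ A) (hS : S ∈ finGenSubalgebras V) : IsProbabilityMeasure (ν S) :=
    isProbabilityMeasure_of_integral_eq (by simpa using hL1) (hL' S hS)
  have hintS (S : Subalgebra ℝ A) (hS : S ∈ finGenSubalgebras V) (a : S) :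
      Integrable (fun α : Character S => α a) (ν S) :=
    integrable_eval_of_integral_eq (by simpa using hL1) (hL' S hS) a
  let U : Ultrafilter (Finset V) := Ultrafilter.of atTop
  have hU : (U : Filter (Finset V)) ≤ atTop := Ultrafilter.of_le _
  let ν' : ∀ F : Finset V, Measure (Character (adjoinFinset F)) := fun F => ν (adjoinFinset F)
  have hν' (F : Finset V) : IsProbabilityMeasure (ν' F) := hprob _ (adjoinFinset_mem F)
  have hmeas (F : Finset V) : Measurable (extendZeroEReal (adjoinFinset F)) :=
    (continuous_extendZeroEReal _).measurable
  let m : Finset V → Measure (ERealFun A) := fun F => (ν' F).map (extendZeroEReal (adjoinFinset F))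
  have hm (F : Finset V) : IsProbabilityMeasure (m F) :=
    Measure.isProbabilityMeasure_map (hmeas F).aemeasurable
  let T : ℕ → Set (Character A) := fun n => charNonneg Q ∩ boundedOn V q.toFun n
  have hT (n : ℕ) : IsCompact (T n) := isCompact_charNonneg_inter_boundedOn hgen Q q.toFun n
  have hTmono : Monotone T := fun n k hnk => Set.inter_subset_inter_right _
    (boundedOn_mono q.toFun_nonneg (Nat.cast_le.2 hnk))
  obtain ⟨μ, hreg, hμprob, hμD, hμlim⟩ := exists_regular_limit_of_concentrated U m
    (D := fun n => toERealFun '' T n) (fun n => (hT n).image isEmbedding_toERealFun.continuous)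
    (fun ε hε => by
      obtain ⟨n, hn⟩ := exists_nat_measure_le_of_concentrated hpq hprob hconc hε
      refine ⟨n, fun O hO hsub => ?_⟩
      filter_upwards [eventually_extendZeroEReal_mem hgen Q q.toFun n U hU hO hsub] with F hF
      rw [Measure.map_apply (hmeas F) hO.measurableSet.compl]
      calc ν' F (extendZeroEReal (adjoinFinset F) ⁻¹' Oᶜ)
          ≤ ν' F ({α | ¬ ∀ v ∈ F, |extendZero (adjoinFinset F) α v| ≤ n * q.toFun v} ∪
              {α | α ∉ charNonnegOn Q (adjoinFinset F)}) := by
            refine measure_mono fun α hα => ?_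
            by_contra hnot
            simp only [Set.mem_union, Set.mem_ofPred_eq, not_or, not_not] at hnot
            exact hα (hF α hnot.1 hnot.2)
        _ ≤ _ := measure_union_le _ _
        _ ≤ ENNReal.ofReal ε := by
            rw [hQ _ (adjoinFinset_mem F), add_zero]
            exact hn _ (adjoinFinset_mem F) F fun v hv => coe_mem_adjoinFinset hv)
  obtain ⟨ρ, hρ, hρmap, hρT⟩ :=
    exists_isRadonMeasure_map_eq isEmbedding_toERealFun hT hTmono μ hμD
  have hρprob : IsProbabilityMeasure ρ :=
    ⟨by rw [← measure_univ (μ := μ), ← hρmap,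
      Measure.map_apply isEmbedding_toERealFun.continuous.measurable .univ, Set.preimage_univ]⟩
  refine ⟨ρ, hρ, fun a => ?_, measure_mono_null ?_ hρT⟩
  · refine (integral_eq_of_tendsto_of_sq (U : Filter (Finset V)) ν'
      (fun F α => extendZero (adjoinFinset F) α a) ρ (continuous_eval a).measurable
      (m := L a) (s := L (a * a)) ?_ fun f => ?_).symm
    · filter_upwards [hU (eventually_mem_adjoinFinset hgen a)] with F ha
      have hsq (α : Character (adjoinFinset F)) :
          α ⟨a, ha⟩ ^ 2 = α (⟨a, ha⟩ * ⟨a, ha⟩) := by rw [map_mul, sq]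
      simp only [extendZero_of_mem _ ha, hsq]
      exact ⟨hintS _ (adjoinFinset_mem F) _, hintS _ (adjoinFinset_mem F) _,
        (hL _ (adjoinFinset_mem F) _).symm, (hL _ (adjoinFinset_mem F) _).symm⟩
    · have hf := hμlim (f.comp (ERealFun.eval a))
      have hfm {κ : Measure (ERealFun A)} :
          AEStronglyMeasurable (f.comp (ERealFun.eval a)) κ :=
        (f.comp (ERealFun.eval a)).continuous.measurable.aestronglyMeasurable
      rw [← hρmap, integral_map isEmbedding_toERealFun.continuous.aemeasurable hfm] at hf
      refine hf.congr fun F => ?_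
      exact integral_map (hmeas F).aemeasurable hfm
  · intro α hα hαT
    obtain ⟨n, hn⟩ := Set.mem_iUnion.1 hαT
    exact hα ⟨hn.1, (qContOn_iff_exists_nat q.toFun_nonneg).2 ⟨n, hn.2⟩⟩

end Character

end

/-- Theorem `MainThm-supp`: criterion with support localization in
`K_Q` for a quadratic module `Q`. -/
theorem statement1 {A : Type*} [CommRing A] [Algebra ℝ A]
    (V : Submodule ℝ A) (hgen : Algebra.adjoin ℝ (V : Set A) = ⊤)
    (Q : Set A) (hQ : IsQuadraticModule Q)
    (q : HilbSeminorm ↥V)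
    (hT : ∃ α : Character A, α ∈ charNonneg Q ∧ QContOn V q.toFun α)
    (L : A →ₗ[ℝ] ℝ) (hL1 : L 1 = 1) :
    (∃ ν : Measure (Character A), IsRadonMeasure ν ∧
        (∀ a : A, L a = ∫ α : Character A, α a ∂ν) ∧
        ν {α : Character A | ¬ (α ∈ charNonneg Q ∧ QContOn V q.toFun α)} = 0) ↔
    (∃ p : HilbSeminorm ↥V, p.trace q < ⊤ ∧
      ∃ ν : ∀ S : Subalgebra ℝ A, Measure (Character ↥S),
        (∀ S ∈ finGenSubalgebras V, IsRadonMeasure (ν S) ∧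
          (∀ a : S, L (a : A) = ∫ α : Character ↥S, α a ∂(ν S)) ∧
          ν S {α : Character ↥S | α ∉ charNonnegOn Q S} = 0) ∧
        Concentrated V (finGenSubalgebras V) p.toFun ν) := by
  constructor
  · rintro ⟨μ, hμ, hL, hsupp⟩
    exact exists_concentrated_of_representing V Q q L hL1 μ hμ hL hsupp
  · rintro ⟨p, hpq, ν, hν, hconc⟩
    obtain ⟨α, -⟩ := hT
    have : Nonempty (Character A) := ⟨α⟩
    exact Character.exists_representing_of_concentrated V hgen Q q L hL1 hpq ν
      (fun S hS => (hν S hS).2.1) (fun S hS => (hν S hS).2.2) hconc
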